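/- Let X be an (M,p̄)-cookie random walk. Then the speed is strictly positive, i.e. lim_{n→∞} X_n/n = v(M,p̄) > 0, if and only if α(M,p̄) > 1. -/

import Mathlib

open MeasureTheory ProbabilityTheory Filter Finset Topology Asymptotics
open scoped ENNReal NNReal

noncomputable section

/-- Strength of the `i`-th cookie (1-indexed): `p i` for `1 ≤ i ≤ M`, `1/2` otherwise. -/
def strength (M : ℕ) (p : Fin M → ℝ) (i : ℕ) : ℝ :=
  if h : 1 ≤ i ∧ i ≤ M then p ⟨i - 1, by omega⟩ else 1 / 2

/-- `α(M,p̄) = Σ_{i=1}^M (2 p_i − 1) − 1`. -/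
def cookieAlpha (M : ℕ) (p : Fin M → ℝ) : ℝ := (∑ i, (2 * p i - 1)) - 1

/-- `X` is an `(M,p̄)`-cookie random walk under the probability measure `P`: it starts at `0`,
is a nearest-neighbour path, and conditionally on the past it jumps to the right with
probability given by the strength of the cookie corresponding to the number of previous
visits to the current site. -/
structure IsCookieRW {Ω : Type*} [MeasurableSpace Ω] (M : ℕ) (p : Fin M → ℝ)
    (P : Measure Ω) (X : ℕ → Ω → ℤ) : Prop where
  isProb : IsProbabilityMeasure P
  meas : ∀ n, Measurable (X n)
  init : P {ω | X 0 ω = 0} = 1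
  nearest : P {ω | ∀ n, |X (n + 1) ω - X n ω| = 1} = 1
  step : ∀ (n : ℕ) (x : ℕ → ℤ),
    P {ω | (∀ k ≤ n, X k ω = x k) ∧ X (n + 1) ω = x n + 1}
      = ENNReal.ofReal
          (strength M p (((Finset.range (n + 1)).filter fun i => x i = x n).card))
        * P {ω | ∀ k ≤ n, X k ω = x k}

theorem measurable_update_pair {ι : Type*} [DecidableEq ι] {E : ι → Type*}
    [∀ i, MeasurableSpace (E i)] (e : ι) :
    Measurable fun a : (∀ i, E i) × E e => Function.update a.1 e a.2 := by
  refine measurable_pi_lambda _ fun i => ?_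
  by_cases h : i = e
  · subst h
    simpa using measurable_snd
  · simp only [Function.update_of_ne h]
    exact (measurable_pi_apply i).comp measurable_fst

/-- Resampling one coordinate of a product measure leaves it invariant. -/
theorem map_update_infinitePi {ι : Type*} [DecidableEq ι] {E : ι → Type*}
    [∀ i, MeasurableSpace (E i)] (μ : (i : ι) → Measure (E i)) [∀ i, IsProbabilityMeasure (μ i)]
    (e : ι) :
    ((Measure.infinitePi μ).prod (μ e)).map (fun a => Function.update a.1 e a.2)
      = Measure.infinitePi μ := by
  have hmeas := measurable_update_pair (E := E) e
  refine Measure.eq_infinitePi μ fun s t ht => ?_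
  rw [Measure.map_apply hmeas (MeasurableSet.pi s.countable_toSet fun i _ => ht i)]
  have hpre : (fun a : (∀ i, E i) × E e => Function.update a.1 e a.2) ⁻¹' (Set.pi s t)
      = (Set.pi (s.erase e : Finset ι) t) ×ˢ (if e ∈ s then t e else Set.univ) := by
    ext ⟨ω, b⟩
    simp only [Set.mem_preimage, Set.mem_pi, Finset.mem_coe, Set.mem_prod, Finset.mem_erase]
    constructor
    · intro h
      refine ⟨fun i hi => by simpa [Function.update_of_ne hi.1] using h i hi.2, ?_⟩
      split_ifs with he
      · simpa using h e he
      · trivial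
    · rintro ⟨h1, h2⟩ i hi
      by_cases hie : i = e
      · subst hie
        simpa [hi] using h2
      · simpa [Function.update_of_ne hie] using h1 i ⟨hie, hi⟩
  rw [hpre, Measure.prod_prod, Measure.infinitePi_pi μ fun i _ => ht i]
  split_ifs with he
  · rw [Finset.prod_erase_mul _ _ he]
  · rw [Finset.erase_eq_of_notMem he]
    simp

theorem lintegral_infinitePi_update {ι : Type*} [DecidableEq ι] {E : ι → Type*}
    [∀ i, MeasurableSpace (E i)] (μ : (i : ι) → Measure (E i)) [∀ i, IsProbabilityMeasure (μ i)]
    (e : ι) {f : (∀ i, E i) → ℝ≥0∞} (hf : Measurable f) :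
    ∫⁻ ω, f ω ∂Measure.infinitePi μ
      = ∫⁻ ω, ∫⁻ b, f (Function.update ω e b) ∂μ e ∂Measure.infinitePi μ := by
  conv_lhs => rw [← map_update_infinitePi μ e]
  rw [lintegral_map hf (measurable_update_pair e), lintegral_prod]
  exact (hf.comp (measurable_update_pair e)).aemeasurable

theorem integral_infinitePi_update {ι : Type*} [DecidableEq ι] {E : ι → Type*}
    [∀ i, MeasurableSpace (E i)] (μ : (i : ι) → Measure (E i)) [∀ i, IsProbabilityMeasure (μ i)]
    (e : ι) {f : (∀ i, E i) → ℝ} (hf : Measurable f) (hfi : Integrable f (Measure.infinitePi μ)) :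
    ∫ ω, f ω ∂Measure.infinitePi μ
      = ∫ ω, ∫ b, f (Function.update ω e b) ∂μ e ∂Measure.infinitePi μ := by
  conv_lhs => rw [← map_update_infinitePi μ e]
  rw [integral_map (measurable_update_pair e).aemeasurable hf.aestronglyMeasurable, integral_prod]
  rw [← map_update_infinitePi μ e] at hfi
  exact hfi.comp_measurable (measurable_update_pair e)

/-- Law of the coins of one site: independent, the `i`-th one (0-indexed) shows `true` with
probability `q i`. -/
def siteMeasure (q : ℕ → unitInterval) : Measure (ℕ → Bool) :=
  Measure.infinitePi fun i => bernoulliMeasure true false (q i)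

instance (q : ℕ → unitInterval) : IsProbabilityMeasure (siteMeasure q) := by
  unfold siteMeasure; infer_instance

/-- Number of successes among the first `m` coins. -/
def succs (w : ℕ → Bool) (m : ℕ) : ℕ := ∑ i ∈ range m, if w i then 1 else 0

/-- Number of failures among the first `m` coins. -/
def fails (w : ℕ → Bool) (m : ℕ) : ℕ := ∑ i ∈ range m, if w i then 0 else 1

/-- Successes among the first `m` coins, the tossing being stopped at the `(z+1)`-th success. -/
def stoppedSuccs (z : ℕ) (w : ℕ → Bool) (m : ℕ) : ℕ :=
  ∑ i ∈ range m, if succs w i ≤ z ∧ w i then 1 else 0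

/-- Failures among the first `m` coins, the tossing being stopped at the `(z+1)`-th success. -/
def stoppedFails (z : ℕ) (w : ℕ → Bool) (m : ℕ) : ℕ :=
  ∑ i ∈ range m, if succs w i ≤ z ∧ ¬ w i then 1 else 0

theorem succs_succ (w : ℕ → Bool) (m : ℕ) :
    succs w (m + 1) = succs w m + if w m then 1 else 0 := sum_range_succ _ _

theorem fails_succ (w : ℕ → Bool) (m : ℕ) :
    fails w (m + 1) = fails w m + if w m then 0 else 1 := sum_range_succ _ _

theorem succs_add_fails (w : ℕ → Bool) (m : ℕ) : succs w m + fails w m = m := by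
  induction m with
  | zero => simp [succs, fails]
  | succ m ih => rw [succs_succ, fails_succ]; split_ifs <;> omega

theorem succs_mono (w : ℕ → Bool) : Monotone (succs w) :=
  monotone_nat_of_le_succ fun m => by rw [succs_succ]; omega

theorem fails_mono (w : ℕ → Bool) : Monotone (fails w) :=
  monotone_nat_of_le_succ fun m => by rw [fails_succ]; omega

theorem succs_le (w : ℕ → Bool) (m : ℕ) : succs w m ≤ m := by
  have := succs_add_fails w m; omega

theorem stoppedSuccs_succ (z : ℕ) (w : ℕ → Bool) (m : ℕ) : stoppedSuccs z w (m + 1)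
    = stoppedSuccs z w m + if succs w m ≤ z ∧ w m then 1 else 0 := sum_range_succ _ _

theorem stoppedFails_succ (z : ℕ) (w : ℕ → Bool) (m : ℕ) : stoppedFails z w (m + 1)
    = stoppedFails z w m + if succs w m ≤ z ∧ ¬ w m then 1 else 0 := sum_range_succ _ _

theorem stoppedSuccs_eq_min (z : ℕ) (w : ℕ → Bool) (m : ℕ) :
    stoppedSuccs z w m = min (succs w m) (z + 1) := by
  induction m with
  | zero => simp [stoppedSuccs, succs]
  | succ m ih =>
    rw [stoppedSuccs_succ, succs_succ, ih]
    by_cases h : w m = true <;> by_cases h' : succs w m ≤ z <;> simp [h, h'] <;> omega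

theorem stoppedFails_eq_fails {z : ℕ} {w : ℕ → Bool} {m : ℕ} (h : succs w m ≤ z) :
    stoppedFails z w m = fails w m := by
  induction m with
  | zero => simp [stoppedFails, fails]
  | succ m ih =>
    have h1 : succs w m ≤ z := (succs_mono w m.le_succ).trans h
    rw [stoppedFails_succ, fails_succ, ih h1]
    by_cases h : w m = true <;> simp [h, h1]

theorem stoppedFails_mono (z : ℕ) (w : ℕ → Bool) : Monotone (stoppedFails z w) :=
  monotone_nat_of_le_succ fun m => by rw [stoppedFails_succ]; omega

theorem stoppedFails_le_fails (z : ℕ) (w : ℕ → Bool) (m : ℕ) :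
    stoppedFails z w m ≤ fails w m := by
  refine sum_le_sum fun i _ => ?_
  by_cases h : w i = true <;> by_cases h' : succs w i ≤ z <;> simp [h, h']

theorem succs_update {w : ℕ → Bool} {m i : ℕ} (h : i ≤ m) (b : Bool) :
    succs (Function.update w m b) i = succs w i :=
  sum_congr rfl fun j hj => by
    rw [Function.update_of_ne (by have := mem_range.1 hj; omega)]

theorem stoppedSuccs_update (z : ℕ) {w : ℕ → Bool} {m i : ℕ} (h : i ≤ m) (b : Bool) :
    stoppedSuccs z (Function.update w m b) i = stoppedSuccs z w i := by
  rw [stoppedSuccs_eq_min, stoppedSuccs_eq_min, succs_update h]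

theorem stoppedFails_update (z : ℕ) {w : ℕ → Bool} {m i : ℕ} (h : i ≤ m) (b : Bool) :
    stoppedFails z (Function.update w m b) i = stoppedFails z w i :=
  sum_congr rfl fun j hj => by
    have := mem_range.1 hj
    rw [Function.update_of_ne (by omega), succs_update (by omega)]

theorem measurable_succs (m : ℕ) : Measurable fun w : ℕ → Bool => succs w m := by
  unfold succs
  refine Finset.measurable_sum _ fun i _ => ?_
  exact (measurable_of_countable fun b : Bool => if b then 1 else 0).comp (measurable_pi_apply i)

theorem measurable_stoppedSuccs (z m : ℕ) :
    Measurable fun w : ℕ → Bool => stoppedSuccs z w m := by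
  simp only [stoppedSuccs_eq_min]
  exact (measurable_of_countable fun k : ℕ => min k (z + 1)).comp (measurable_succs m)

theorem measurable_stoppedFails (z m : ℕ) :
    Measurable fun w : ℕ → Bool => stoppedFails z w m := by
  unfold stoppedFails
  refine Finset.measurable_sum _ fun i _ => ?_
  exact (measurable_of_countable fun a : ℕ × Bool => if a.1 ≤ z ∧ ¬ a.2 then 1 else 0).comp
    ((measurable_succs i).prodMk (measurable_pi_apply i))

theorem integral_siteMeasure_step (q : ℕ → unitInterval) (m : ℕ) {f : (ℕ → Bool) → ℝ}
    (hf : Measurable f) (hfi : Integrable f (siteMeasure q)) :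
    ∫ w, f w ∂siteMeasure q
      = ∫ w, ((q m : ℝ) * f (Function.update w m true)
          + (1 - (q m : ℝ)) * f (Function.update w m false)) ∂siteMeasure q := by
  unfold siteMeasure at *
  rw [integral_infinitePi_update _ m hf hfi]
  refine integral_congr_ae (ae_of_all _ fun w => ?_)
  simp only [integral_bernoulliMeasure, smul_eq_mul]

/-- Accumulated bias of the coins tossed before time `m`, stopped at the `(z+1)`-th success. -/
def stoppedBias (q : ℕ → unitInterval) (z : ℕ) (w : ℕ → Bool) (m : ℕ) : ℝ :=
  ∑ i ∈ range m, if succs w i ≤ z then 2 * (q i : ℝ) - 1 else 0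

/-- Accumulated variance of the coins tossed before time `m`, stopped at the `(z+1)`-th
success. -/
def stoppedVar (q : ℕ → unitInterval) (z : ℕ) (w : ℕ → Bool) (m : ℕ) : ℝ :=
  ∑ i ∈ range m, if succs w i ≤ z then 1 - (2 * (q i : ℝ) - 1) ^ 2 else 0

/-- The compensated difference between failures and successes. -/
def siteMart (q : ℕ → unitInterval) (z : ℕ) (w : ℕ → Bool) (m : ℕ) : ℝ :=
  stoppedFails z w m - stoppedSuccs z w m + stoppedBias q z w m

section

variable (q : ℕ → unitInterval) (z : ℕ)

theorem stoppedBias_succ (w : ℕ → Bool) (m : ℕ) : stoppedBias q z w (m + 1)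
    = stoppedBias q z w m + if succs w m ≤ z then 2 * (q m : ℝ) - 1 else 0 := sum_range_succ _ _

theorem stoppedVar_succ (w : ℕ → Bool) (m : ℕ) : stoppedVar q z w (m + 1)
    = stoppedVar q z w m + if succs w m ≤ z then 1 - (2 * (q m : ℝ) - 1) ^ 2 else 0 :=
  sum_range_succ _ _

theorem stoppedBias_update {w : ℕ → Bool} {m i : ℕ} (h : i ≤ m) (b : Bool) :
    stoppedBias q z (Function.update w m b) i = stoppedBias q z w i :=
  sum_congr rfl fun j hj => by
    have := mem_range.1 hj
    rw [succs_update (by omega)]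

theorem measurable_stoppedBias (m : ℕ) : Measurable fun w : ℕ → Bool => stoppedBias q z w m := by
  unfold stoppedBias
  refine Finset.measurable_sum _ fun i _ => ?_
  exact (measurable_of_countable fun a : ℕ => if a ≤ z then 2 * (q i : ℝ) - 1 else 0).comp
    (measurable_succs i)

theorem measurable_stoppedVar (m : ℕ) : Measurable fun w : ℕ → Bool => stoppedVar q z w m := by
  unfold stoppedVar
  refine Finset.measurable_sum _ fun i _ => ?_
  exact (measurable_of_countable
    fun a : ℕ => if a ≤ z then 1 - (2 * (q i : ℝ) - 1) ^ 2 else 0).comp (measurable_succs i)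

theorem measurable_siteMart (m : ℕ) : Measurable fun w : ℕ → Bool => siteMart q z w m :=
  (((measurable_of_countable fun k : ℕ => (k : ℝ)).comp (measurable_stoppedFails z m)).sub
    ((measurable_of_countable fun k : ℕ => (k : ℝ)).comp (measurable_stoppedSuccs z m))).add
    (measurable_stoppedBias q z m)

theorem abs_bias_le (i : ℕ) : |2 * (q i : ℝ) - 1| ≤ 1 := by
  have h0 := (q i).2.1
  have h1 := (q i).2.2
  rw [abs_le]; constructor <;> linarith

theorem abs_stoppedBias_le (w : ℕ → Bool) (m : ℕ) : |stoppedBias q z w m| ≤ m := by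
  refine (abs_sum_le_sum_abs _ _).trans ?_
  calc _ ≤ ∑ i ∈ range m, (1 : ℝ) := sum_le_sum fun i _ => by
        split_ifs
        · exact abs_bias_le q i
        · simp
    _ = m := by simp

theorem abs_stoppedVar_le (w : ℕ → Bool) (m : ℕ) : |stoppedVar q z w m| ≤ m := by
  refine (abs_sum_le_sum_abs _ _).trans ?_
  calc _ ≤ ∑ i ∈ range m, (1 : ℝ) := sum_le_sum fun i _ => by
        split_ifs
        · have h := abs_bias_le q i
          rw [← sq_le_one_iff_abs_le_one] at h
          rw [abs_le]; constructor <;> nlinarith [sq_nonneg (2 * (q i : ℝ) - 1)]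
        · simp
    _ = m := by simp

theorem stoppedFails_le (w : ℕ → Bool) (m : ℕ) : stoppedFails z w m ≤ m := by
  have := stoppedFails_le_fails z w m
  have := succs_add_fails w m
  omega

theorem stoppedSuccs_le (w : ℕ → Bool) (m : ℕ) : stoppedSuccs z w m ≤ m := by
  have := succs_le w m
  rw [stoppedSuccs_eq_min]
  omega

theorem abs_siteMart_le (w : ℕ → Bool) (m : ℕ) : |siteMart q z w m| ≤ 3 * m := by
  have h1 := abs_stoppedBias_le q z w m
  have h2 : (stoppedFails z w m : ℝ) ≤ m := by exact_mod_cast stoppedFails_le z w m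
  have h3 : (stoppedSuccs z w m : ℝ) ≤ m := by exact_mod_cast stoppedSuccs_le z w m
  have h4 : (0 : ℝ) ≤ stoppedFails z w m := by positivity
  have h5 : (0 : ℝ) ≤ stoppedSuccs z w m := by positivity
  unfold siteMart
  rw [abs_le] at *
  constructor <;> linarith

theorem integrable_siteMart (m : ℕ) : Integrable (fun w => siteMart q z w m) (siteMeasure q) :=
  Integrable.of_bound (measurable_siteMart q z m).aestronglyMeasurable (3 * m)
    (ae_of_all _ fun w => abs_siteMart_le q z w m)

theorem integrable_siteMart_sq (m : ℕ) :
    Integrable (fun w => siteMart q z w m ^ 2) (siteMeasure q) :=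
  Integrable.of_bound ((measurable_siteMart q z m).pow_const 2).aestronglyMeasurable
    ((3 * m) ^ 2) (ae_of_all _ fun w => by
      rw [norm_pow]
      exact pow_le_pow_left₀ (norm_nonneg _) (abs_siteMart_le q z w m) 2)

theorem integrable_stoppedVar (m : ℕ) :
    Integrable (fun w => stoppedVar q z w m) (siteMeasure q) :=
  Integrable.of_bound (measurable_stoppedVar q z m).aestronglyMeasurable m
    (ae_of_all _ fun w => abs_stoppedVar_le q z w m)

theorem siteMart_succ_update (w : ℕ → Bool) (m : ℕ) (b : Bool) :
    siteMart q z (Function.update w m b) (m + 1) = siteMart q z w m +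
      if succs w m ≤ z then (if b then 2 * (q m : ℝ) - 2 else 2 * (q m : ℝ)) else 0 := by
  unfold siteMart
  rw [stoppedFails_succ, stoppedSuccs_succ, stoppedBias_succ, stoppedBias_update q z le_rfl,
    stoppedFails_update z le_rfl, stoppedSuccs_update z le_rfl, succs_update le_rfl,
    Function.update_self]
  by_cases h : succs w m ≤ z <;> cases b <;> simp [h] <;> ring

theorem integral_siteMart (m : ℕ) : ∫ w, siteMart q z w m ∂siteMeasure q = 0 := by
  induction m with
  | zero => simp [siteMart, stoppedFails, stoppedSuccs, stoppedBias]
  | succ m ih =>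
    rw [integral_siteMeasure_step q m (measurable_siteMart q z _) (integrable_siteMart q z _), ← ih]
    refine integral_congr_ae (ae_of_all _ fun w => ?_)
    simp only [siteMart_succ_update]
    by_cases h : succs w m ≤ z <;> simp [h] <;> ring

theorem integral_siteMart_sq (m : ℕ) :
    ∫ w, siteMart q z w m ^ 2 ∂siteMeasure q = ∫ w, stoppedVar q z w m ∂siteMeasure q := by
  induction m with
  | zero => simp [siteMart, stoppedFails, stoppedSuccs, stoppedBias, stoppedVar]
  | succ m ih =>
    rw [integral_siteMeasure_step q m ((measurable_siteMart q z _).pow_const 2)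
      (integrable_siteMart_sq q z _)]
    have hI : Integrable (fun w => stoppedVar q z w (m + 1) - stoppedVar q z w m)
        (siteMeasure q) := (integrable_stoppedVar q z (m + 1)).sub (integrable_stoppedVar q z m)
    have h1 : ∀ w, (q m : ℝ) * siteMart q z (Function.update w m true) (m + 1) ^ 2
        + (1 - (q m : ℝ)) * siteMart q z (Function.update w m false) (m + 1) ^ 2
        = siteMart q z w m ^ 2 + (stoppedVar q z w (m + 1) - stoppedVar q z w m) := by
      intro w
      simp only [siteMart_succ_update, stoppedVar_succ]
      by_cases h : succs w m ≤ z <;> simp [h] <;> ring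
    simp only [h1]
    rw [integral_add (integrable_siteMart_sq q z m) hI, ih,
      integral_sub (integrable_stoppedVar q z (m + 1)) (integrable_stoppedVar q z m)]
    ring

end

open Classical in
/-- Number of failures before the `(z+1)`-th success (`0` if there are at most `z` successes). -/
def failsBefore (z : ℕ) (w : ℕ → Bool) : ℕ :=
  if h : ∃ m, z < succs w m then fails w (Nat.find h) else 0

theorem fails_le_failsBefore {z m : ℕ} {w : ℕ → Bool} (h : ∃ m, z < succs w m)
    (hm : succs w m ≤ z) : fails w m ≤ failsBefore z w := by
  classical
  rw [failsBefore, dif_pos h]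
  refine fails_mono w ?_
  by_contra! hlt
  have := succs_mono w hlt.le
  have := Nat.find_spec h
  omega

theorem failsBefore_le_fails {z m : ℕ} {w : ℕ → Bool} (hm : z < succs w m) :
    failsBefore z w ≤ fails w m := by
  classical
  have h : ∃ m, z < succs w m := ⟨m, hm⟩
  rw [failsBefore, dif_pos h]
  exact fails_mono w (Nat.find_min' h hm)

theorem failsBefore_mono {y z : ℕ} {w : ℕ → Bool} (h : ∃ m, z < succs w m) (hyz : y ≤ z) :
    failsBefore y w ≤ failsBefore z w := by
  classical
  obtain ⟨m, hm⟩ := h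
  have h : ∃ m, z < succs w m := ⟨m, hm⟩
  conv_rhs => rw [failsBefore, dif_pos h]
  exact failsBefore_le_fails (hyz.trans_lt (Nat.find_spec h))

theorem stoppedFails_eq_failsBefore {z m : ℕ} {w : ℕ → Bool} (hm : z < succs w m) :
    stoppedFails z w m = failsBefore z w := by
  classical
  have h : ∃ m, z < succs w m := ⟨m, hm⟩
  rw [failsBefore, dif_pos h]
  have hle := Nat.find_min' h hm
  induction m, hle using Nat.le_induction with
  | base =>
    obtain ⟨t, ht⟩ : ∃ t, Nat.find h = t + 1 := by
      refine Nat.exists_eq_succ_of_ne_zero fun h0 => ?_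
      have := Nat.find_spec h
      rw [h0] at this
      simp [succs] at this
    have h1 : succs w t ≤ z := by
      have := Nat.find_min h (m := t) (by omega)
      omega
    rw [ht, stoppedFails_succ, fails_succ, stoppedFails_eq_fails h1]
    by_cases hw : w t = true <;> simp [hw, h1]
  | succ n hn ih =>
    have h1 : z < succs w n := (Nat.find_spec h).trans_le (succs_mono w hn)
    rw [stoppedFails_succ, ih h1]
    simp [Nat.not_le.2 h1]

theorem stoppedFails_le_failsBefore {z : ℕ} {w : ℕ → Bool} (h : ∃ m, z < succs w m) (m : ℕ) :
    stoppedFails z w m ≤ failsBefore z w := by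
  obtain ⟨t, ht⟩ := h
  rw [← stoppedFails_eq_failsBefore (ht.trans_le (succs_mono w (le_max_right m t)))]
  exact stoppedFails_mono z w (le_max_left m t)

theorem measurable_failsBefore (z : ℕ) : Measurable (failsBefore z) := by
  refine measurable_of_tendsto_metrizable
    (f := fun m w => if z < succs w m then stoppedFails z w m else 0) (fun m => ?_) ?_
  · exact (measurable_of_countable fun a : ℕ × ℕ => if z < a.1 then a.2 else 0).comp
      ((measurable_succs m).prodMk (measurable_stoppedFails z m))
  · rw [tendsto_pi_nhds]
    intro w
    by_cases h : ∃ m, z < succs w m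
    · obtain ⟨m, hm⟩ := h
      refine tendsto_const_nhds.congr' ?_
      filter_upwards [eventually_ge_atTop m] with t ht
      have h1 := hm.trans_le (succs_mono w ht)
      rw [if_pos h1, stoppedFails_eq_failsBefore h1]
    · refine tendsto_const_nhds.congr fun m => ?_
      rw [if_neg fun hm => h ⟨m, hm⟩, failsBefore, dif_neg h]

theorem measurable_failsBefore_uncurry :
    Measurable fun a : ℕ × (ℕ → Bool) => failsBefore a.1 a.2 :=
  measurable_from_prod_countable_right measurable_failsBefore

theorem integrable_stoppedFails (q : ℕ → unitInterval) (z m : ℕ) :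
    Integrable (fun w => (stoppedFails z w m : ℝ)) (siteMeasure q) :=
  Integrable.of_bound ((measurable_of_countable fun k : ℕ => (k : ℝ)).comp
    (measurable_stoppedFails z m)).aestronglyMeasurable m
    (ae_of_all _ fun w => by simpa using stoppedFails_le z w m)

theorem integrable_stoppedSuccs (q : ℕ → unitInterval) (z m : ℕ) :
    Integrable (fun w => (stoppedSuccs z w m : ℝ)) (siteMeasure q) :=
  Integrable.of_bound ((measurable_of_countable fun k : ℕ => (k : ℝ)).comp
    (measurable_stoppedSuccs z m)).aestronglyMeasurable m
    (ae_of_all _ fun w => by simpa using stoppedSuccs_le z w m)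

theorem stoppedSuccs_le_succ (z : ℕ) (w : ℕ → Bool) (m : ℕ) : stoppedSuccs z w m ≤ z + 1 := by
  rw [stoppedSuccs_eq_min]; exact min_le_right _ _

theorem integral_stoppedSuccs_le (q : ℕ → unitInterval) (z m : ℕ) :
    ∫ w, (stoppedSuccs z w m : ℝ) ∂siteMeasure q ≤ z + 1 := by
  calc _ ≤ ∫ _, ((z : ℝ) + 1) ∂siteMeasure q :=
        integral_mono (integrable_stoppedSuccs q z m) (integrable_const _) fun w => by
          have h : (stoppedSuccs z w m : ℝ) ≤ ((z + 1 : ℕ) : ℝ) :=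
            Nat.cast_le.2 (stoppedSuccs_le_succ z w m)
          simpa using h
    _ = z + 1 := by simp

theorem integral_stoppedFails_le {q : ℕ → unitInterval} (hq : ∀ i, 1 / 2 ≤ (q i : ℝ)) (z m : ℕ) :
    ∫ w, (stoppedFails z w m : ℝ) ∂siteMeasure q ≤ z + 1 := by
  have hA : ∀ w, 0 ≤ stoppedBias q z w m := fun w => sum_nonneg fun i _ => by
    split_ifs
    · linarith [hq i]
    · rfl
  calc _ ≤ ∫ w, (siteMart q z w m + stoppedSuccs z w m) ∂siteMeasure q :=
        integral_mono (integrable_stoppedFails q z m)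
          ((integrable_siteMart q z m).add (integrable_stoppedSuccs q z m)) fun w => by
            simp only [siteMart]
            linarith [hA w]
    _ ≤ z + 1 := by
        rw [integral_add (integrable_siteMart q z m) (integrable_stoppedSuccs q z m),
          integral_siteMart, zero_add]
        exact integral_stoppedSuccs_le q z m

theorem stoppedFails_add_stoppedSuccs {z m : ℕ} {w : ℕ → Bool} (h : succs w m ≤ z) :
    stoppedFails z w m + stoppedSuccs z w m = m := by
  rw [stoppedFails_eq_fails h, stoppedSuccs_eq_min, min_eq_left (by omega), add_comm,
    succs_add_fails]

/-- Almost surely a site with coins biased to the right has infinitely many successes. -/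
theorem ae_exists_lt_succs {q : ℕ → unitInterval} (hq : ∀ i, 1 / 2 ≤ (q i : ℝ)) :
    ∀ᵐ w ∂siteMeasure q, ∀ z, ∃ m, z < succs w m := by
  rw [ae_all_iff]
  intro z
  have hbound : ∀ m : ℕ, (m : ℝ) * (siteMeasure q).real {w | succs w m ≤ z} ≤ 2 * (z + 1) := by
    intro m
    have hms : MeasurableSet {w : ℕ → Bool | succs w m ≤ z} :=
      measurableSet_le (measurable_succs m) measurable_const
    calc (m : ℝ) * (siteMeasure q).real {w | succs w m ≤ z}
        = ∫ w, {w : ℕ → Bool | succs w m ≤ z}.indicator (fun _ => (m : ℝ)) w ∂siteMeasure q := by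
          rw [integral_indicator_const _ hms, smul_eq_mul, mul_comm]
      _ ≤ ∫ w, ((stoppedFails z w m : ℝ) + stoppedSuccs z w m) ∂siteMeasure q := by
          refine integral_mono ((integrable_const _).indicator hms)
            ((integrable_stoppedFails q z m).add (integrable_stoppedSuccs q z m)) fun w => ?_
          by_cases hw : w ∈ {w : ℕ → Bool | succs w m ≤ z}
          · rw [Set.indicator_of_mem hw]
            rw [← Nat.cast_add, stoppedFails_add_stoppedSuccs hw]
          · rw [Set.indicator_of_notMem hw]
            positivity
      _ ≤ 2 * (z + 1) := by
          rw [integral_add (integrable_stoppedFails q z m) (integrable_stoppedSuccs q z m)]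
          linarith [integral_stoppedFails_le hq z m, integral_stoppedSuccs_le q z m]
  rw [ae_iff]
  set A := {w : ℕ → Bool | ¬ ∃ m, z < succs w m}
  have hA : ∀ m : ℕ, (m : ℝ) * (siteMeasure q).real A ≤ 2 * (z + 1) := fun m => by
    refine le_trans ?_ (hbound m)
    gcongr
    · exact measure_ne_top _ _
    intro w hw
    simp only [A, Set.mem_ofPred_eq, not_exists, not_lt] at hw
    exact hw m
  rw [← measureReal_eq_zero_iff]
  by_contra hne
  have hpos : 0 < (siteMeasure q).real A := lt_of_le_of_ne measureReal_nonneg (Ne.symm hne)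
  obtain ⟨m, hm⟩ := exists_nat_gt (2 * ((z : ℝ) + 1) / (siteMeasure q).real A)
  rw [div_lt_iff₀ hpos] at hm
  linarith [hA m]

section

variable {q : ℕ → unitInterval} (hq : ∀ i, 1 / 2 ≤ (q i : ℝ)) {M : ℕ}
  (hM : ∀ i, M ≤ i → (q i : ℝ) = 1 / 2) {z : ℕ} (hz : M ≤ z)

theorem sum_range_active {M z m : ℕ} (hz : M ≤ z) (hm : M ≤ m) {f : ℕ → ℝ}
    (hf : ∀ i, M ≤ i → f i = 0) (w : ℕ → Bool) :
    ∑ i ∈ range m, (if succs w i ≤ z then f i else 0) = ∑ i ∈ range M, f i := by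
  rw [← sum_subset (range_mono hm) (f := fun i => if succs w i ≤ z then f i else 0)]
  · refine sum_congr rfl fun i hi => if_pos ?_
    have := mem_range.1 hi
    have := succs_le w i
    omega
  · intro i _ hi
    rw [hf i (by simpa using hi), ite_self]

include hM hz in
theorem stoppedBias_eq {m : ℕ} (hm : M ≤ m) (w : ℕ → Bool) :
    stoppedBias q z w m = ∑ i ∈ range M, (2 * (q i : ℝ) - 1) :=
  sum_range_active hz hm (fun i hi => by rw [hM i hi]; ring) w

include hM hz in
theorem stoppedVar_eq {m : ℕ} (hm : M ≤ m) (w : ℕ → Bool) :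
    stoppedVar q z w m = stoppedFails z w m + stoppedSuccs z w m
      - ∑ i ∈ range M, (2 * (q i : ℝ) - 1) ^ 2 := by
  rw [← sum_range_active hz hm (f := fun i => (2 * (q i : ℝ) - 1) ^ 2)
    (fun i hi => by rw [hM i hi]; ring) w]
  unfold stoppedVar stoppedFails stoppedSuccs
  push_cast
  rw [← sum_add_distrib, ← sum_sub_distrib]
  refine sum_congr rfl fun i _ => ?_
  by_cases h : succs w i ≤ z <;> by_cases h' : w i = true <;> simp [h, h']

include hq hM hz in
theorem integral_siteMart_sq_le {m : ℕ} (hm : M ≤ m) :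
    ∫ w, siteMart q z w m ^ 2 ∂siteMeasure q ≤ 2 * (z + 1) := by
  rw [integral_siteMart_sq]
  simp only [stoppedVar_eq hM hz hm]
  have hI : Integrable (fun w => (stoppedFails z w m : ℝ) + stoppedSuccs z w m) (siteMeasure q) :=
    (integrable_stoppedFails q z m).add (integrable_stoppedSuccs q z m)
  rw [integral_sub hI (integrable_const _), integral_add (integrable_stoppedFails q z m)
    (integrable_stoppedSuccs q z m)]
  have h0 : 0 ≤ ∑ i ∈ range M, (2 * (q i : ℝ) - 1) ^ 2 := sum_nonneg fun i _ => sq_nonneg _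
  simp only [integral_const, probReal_univ, smul_eq_mul, one_mul]
  linarith [integral_stoppedFails_le hq z m, integral_stoppedSuccs_le q z m]

theorem sum_bias_le (q : ℕ → unitInterval) (M : ℕ) :
    ∑ i ∈ range M, (2 * (q i : ℝ) - 1) ≤ M := by
  calc _ ≤ ∑ i ∈ range M, (1 : ℝ) := sum_le_sum fun i _ => (abs_le.1 (abs_bias_le q i)).2
    _ = M := by simp

include hM hz in
theorem stoppedFails_eq_siteMart {m : ℕ} (hm : M ≤ m) (w : ℕ → Bool) :
    (stoppedFails z w m : ℝ) = siteMart q z w m + stoppedSuccs z w m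
      - ∑ i ∈ range M, (2 * (q i : ℝ) - 1) := by
  rw [siteMart, stoppedBias_eq hM hz hm]
  ring

include hq hM hz in
theorem integral_stoppedFails_sq_le {m : ℕ} (hm : M ≤ m) :
    ∫ w, (stoppedFails z w m : ℝ) ^ 2 ∂siteMeasure q
      ≤ 2 * (z + 1) + (z + 1 - ∑ i ∈ range M, (2 * (q i : ℝ) - 1)) ^ 2 := by
  set c : ℝ := z + 1 - ∑ i ∈ range M, (2 * (q i : ℝ) - 1) with hc
  have hI := (integrable_siteMart q z m).const_mul (2 * c)
  have hI' : Integrable (fun w => siteMart q z w m ^ 2 + 2 * c * siteMart q z w m)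
      (siteMeasure q) := (integrable_siteMart_sq q z m).add hI
  calc _ ≤ ∫ w, (siteMart q z w m ^ 2 + 2 * c * siteMart q z w m + c ^ 2) ∂siteMeasure q := by
        refine integral_mono_of_nonneg (ae_of_all _ fun w => by positivity)
          (((integrable_siteMart_sq q z m).add hI).add (integrable_const _))
          (ae_of_all _ fun w => ?_)
        have h1 : (stoppedFails z w m : ℝ) ≤ siteMart q z w m + c := by
          have h : (stoppedSuccs z w m : ℝ) ≤ ((z + 1 : ℕ) : ℝ) :=
            Nat.cast_le.2 (stoppedSuccs_le_succ z w m)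
          push_cast at h
          rw [stoppedFails_eq_siteMart hM hz hm]
          linarith
        have h2 : (0 : ℝ) ≤ stoppedFails z w m := by positivity
        simp only
        nlinarith
    _ ≤ _ := by
        rw [integral_add hI' (integrable_const _),
          integral_add (integrable_siteMart_sq q z m) hI, integral_const_mul, integral_siteMart]
        simp only [integral_const, probReal_univ, smul_eq_mul, one_mul]
        linarith [integral_siteMart_sq_le hq hM hz hm]

theorem tendsto_stoppedFails {w : ℕ → Bool} (h : ∃ m, z < succs w m) :
    Tendsto (fun m => (stoppedFails z w m : ℝ)) atTop (𝓝 (failsBefore z w)) := by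
  obtain ⟨t, ht⟩ := h
  refine tendsto_const_nhds.congr' ?_
  filter_upwards [eventually_ge_atTop t] with m hm
  rw [stoppedFails_eq_failsBefore (ht.trans_le (succs_mono w hm))]

theorem tendsto_stoppedSuccs {w : ℕ → Bool} (h : ∃ m, z < succs w m) :
    Tendsto (fun m => (stoppedSuccs z w m : ℝ)) atTop (𝓝 (z + 1)) := by
  obtain ⟨t, ht⟩ := h
  refine tendsto_const_nhds.congr' ?_
  filter_upwards [eventually_ge_atTop t] with m hm
  have := ht.trans_le (succs_mono w hm)
  rw [stoppedSuccs_eq_min, min_eq_right (by omega)]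
  push_cast
  ring

theorem measurable_failsBefore_real (z : ℕ) :
    Measurable fun w => (failsBefore z w : ℝ) :=
  (measurable_of_countable fun k : ℕ => (k : ℝ)).comp (measurable_failsBefore z)

theorem integrable_of_tendsto_of_integral_le {α : Type*} [MeasurableSpace α] {μ : Measure α}
    {f : ℕ → α → ℝ} {g : α → ℝ} {C : ℝ} (hg : Measurable g) (hf0 : ∀ n a, 0 ≤ f n a)
    (hfm : ∀ n, Measurable (f n)) (hf : ∀ n, Integrable (f n) μ) (hC : ∀ n, ∫ a, f n a ∂μ ≤ C)
    (hlim : ∀ᵐ a ∂μ, Tendsto (fun n => f n a) atTop (𝓝 (g a))) : Integrable g μ := by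
  refine ⟨hg.aestronglyMeasurable, ?_⟩
  have h1 : ∫⁻ a, ‖g a‖ₑ ∂μ = ∫⁻ a, liminf (fun n => ‖f n a‖ₑ) atTop ∂μ :=
    lintegral_congr_ae (by filter_upwards [hlim] with a ha using ha.enorm.liminf_eq.symm)
  have h2 : ∀ n, ∫⁻ a, ‖f n a‖ₑ ∂μ ≤ ENNReal.ofReal C := fun n => by
    have : ∫⁻ a, ‖f n a‖ₑ ∂μ = ENNReal.ofReal (∫ a, f n a ∂μ) := by
      rw [ofReal_integral_eq_lintegral_ofReal (hf n) (ae_of_all _ (hf0 n))]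
      exact lintegral_congr fun a => Real.enorm_of_nonneg (hf0 n a)
    rw [this]
    exact ENNReal.ofReal_le_ofReal (hC n)
  calc ∫⁻ a, ‖g a‖ₑ ∂μ ≤ liminf (fun n => ∫⁻ a, ‖f n a‖ₑ ∂μ) atTop := by
        rw [h1]
        exact lintegral_liminf_le fun n => (hfm n).enorm
    _ ≤ liminf (fun _ : ℕ => ENNReal.ofReal C) atTop :=
        liminf_le_liminf (Eventually.of_forall h2)
    _ < ⊤ := by simp

theorem measurable_stoppedFails_real (z m : ℕ) :
    Measurable fun w => (stoppedFails z w m : ℝ) :=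
  (measurable_of_countable fun k : ℕ => (k : ℝ)).comp (measurable_stoppedFails z m)

theorem integrable_stoppedFails_sq (q : ℕ → unitInterval) (z m : ℕ) :
    Integrable (fun w => (stoppedFails z w m : ℝ) ^ 2) (siteMeasure q) :=
  Integrable.of_bound ((measurable_stoppedFails_real z m).pow_const 2).aestronglyMeasurable
    ((m : ℝ) ^ 2) (ae_of_all _ fun w => by
      rw [norm_pow]
      have h : (stoppedFails z w m : ℝ) ≤ m := Nat.cast_le.2 (stoppedFails_le z w m)
      exact pow_le_pow_left₀ (norm_nonneg _) (by simpa using h) 2)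

include hq hM in
theorem integrable_failsBefore_sq (z : ℕ) :
    Integrable (fun w => (failsBefore z w : ℝ) ^ 2) (siteMeasure q) := by
  have hmax : Integrable (fun w => (failsBefore (max z M) w : ℝ) ^ 2) (siteMeasure q) := by
    refine integrable_of_tendsto_of_integral_le
      (f := fun m w => (stoppedFails (max z M) w (m + M) : ℝ) ^ 2)
      ((measurable_failsBefore_real _).pow_const 2) (fun n a => by positivity)
      (fun m => (measurable_stoppedFails_real _ _).pow_const 2)
      (fun m => integrable_stoppedFails_sq q _ _)
      (fun m => integral_stoppedFails_sq_le hq hM (le_max_right z M) (Nat.le_add_left M m)) ?_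
    filter_upwards [ae_exists_lt_succs hq] with w hw
    exact (((tendsto_stoppedFails (hw _)).comp (tendsto_add_atTop_nat M)).pow 2)
  refine hmax.mono' ((measurable_failsBefore_real z).pow_const 2).aestronglyMeasurable ?_
  filter_upwards [ae_exists_lt_succs hq] with w hw
  rw [Real.norm_of_nonneg (by positivity)]
  have := failsBefore_mono (hw (max z M)) (le_max_left z M)
  gcongr

include hq hM in
theorem integrable_failsBefore (z : ℕ) :
    Integrable (fun w => (failsBefore z w : ℝ)) (siteMeasure q) :=
  ((memLp_two_iff_integrable_sq (measurable_failsBefore_real z).aestronglyMeasurable).2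
    (integrable_failsBefore_sq hq hM z)).integrable one_le_two

include hq in
theorem tendsto_integral_stoppedSuccs (z : ℕ) :
    Tendsto (fun m => ∫ w, (stoppedSuccs z w m : ℝ) ∂siteMeasure q) atTop (𝓝 (z + 1)) := by
  have h : Tendsto (fun m => ∫ w, (stoppedSuccs z w m : ℝ) ∂siteMeasure q) atTop
      (𝓝 (∫ _, ((z : ℝ) + 1) ∂siteMeasure q)) := by
    refine tendsto_integral_of_dominated_convergence (fun _ => (z : ℝ) + 1)
      (fun m => (integrable_stoppedSuccs q z m).1) (integrable_const _)
      (fun m => ae_of_all _ fun w => ?_) ?_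
    · have h : (stoppedSuccs z w m : ℝ) ≤ ((z + 1 : ℕ) : ℝ) :=
        Nat.cast_le.2 (stoppedSuccs_le_succ z w m)
      simpa using h
    · filter_upwards [ae_exists_lt_succs hq] with w hw using tendsto_stoppedSuccs (hw z)
  simpa using h

include hq hM in
theorem tendsto_integral_stoppedFails (z : ℕ) :
    Tendsto (fun m => ∫ w, (stoppedFails z w m : ℝ) ∂siteMeasure q) atTop
      (𝓝 (∫ w, (failsBefore z w : ℝ) ∂siteMeasure q)) := by
  refine tendsto_integral_of_dominated_convergence (fun w => (failsBefore z w : ℝ))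
    (fun m => (integrable_stoppedFails q z m).1) (integrable_failsBefore hq hM z)
    (fun m => ?_) ?_
  · filter_upwards [ae_exists_lt_succs hq] with w hw
    simpa using stoppedFails_le_failsBefore (hw z) m
  · filter_upwards [ae_exists_lt_succs hq] with w hw using tendsto_stoppedFails (hw z)

include hq hM hz in
/-- Mean number of failures before the `(z+1)`-th success, all cookies being used. -/
theorem integral_failsBefore :
    ∫ w, (failsBefore z w : ℝ) ∂siteMeasure q
      = z + 1 - ∑ i ∈ range M, (2 * (q i : ℝ) - 1) := by
  refine tendsto_nhds_unique (tendsto_integral_stoppedFails hq hM z)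
    (((tendsto_integral_stoppedSuccs hq z).sub_const _).congr' ?_)
  filter_upwards [eventually_ge_atTop M] with m hm
  simp only [stoppedFails_eq_siteMart hM hz hm]
  have hI : Integrable (fun w => siteMart q z w m + stoppedSuccs z w m) (siteMeasure q) :=
    (integrable_siteMart q z m).add (integrable_stoppedSuccs q z m)
  rw [integral_sub hI (integrable_const _), integral_add (integrable_siteMart q z m)
    (integrable_stoppedSuccs q z m), integral_siteMart]
  simp

include hq hM hz in
/-- Second moment of the number of failures before the `(z+1)`-th success, all cookies being
used. -/
theorem integral_failsBefore_sq :
    ∫ w, (failsBefore z w : ℝ) ^ 2 ∂siteMeasure q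
      = (z + 1 - ∑ i ∈ range M, (2 * (q i : ℝ) - 1)) ^ 2 + 2 * (z + 1)
        - ∑ i ∈ range M, (2 * (q i : ℝ) - 1) - ∑ i ∈ range M, (2 * (q i : ℝ) - 1) ^ 2 := by
  set δ : ℝ := ∑ i ∈ range M, (2 * (q i : ℝ) - 1) with hδ
  set κ : ℝ := ∑ i ∈ range M, (2 * (q i : ℝ) - 1) ^ 2 with hκ
  set c : ℝ := z + 1 - δ with hc
  have hδM : δ ≤ M := sum_bias_le q M
  have hδ0 : 0 ≤ δ := sum_nonneg fun i _ => by linarith [hq i]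
  have hF := integrable_failsBefore hq hM z
  have hF2 := integrable_failsBefore_sq hq hM z
  have hlim : Tendsto (fun m => ∫ w, siteMart q z w m ^ 2 ∂siteMeasure q) atTop
      (𝓝 (∫ w, ((failsBefore z w : ℝ) - c) ^ 2 ∂siteMeasure q)) := by
    have hdom : Integrable (fun w => ((failsBefore z w : ℝ) + (z + 1 + M)) ^ 2)
        (siteMeasure q) := by
      have h := (hF2.add (hF.const_mul (2 * ((z : ℝ) + 1 + M)))).add
        (integrable_const (((z : ℝ) + 1 + M) ^ 2))
      refine h.congr (ae_of_all _ fun w => ?_)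
      simp only [Pi.add_apply]
      ring
    refine tendsto_integral_filter_of_dominated_convergence _
      (Eventually.of_forall fun m => (integrable_siteMart_sq q z m).1) ?_ hdom ?_
    · filter_upwards [eventually_ge_atTop M] with m hm
      filter_upwards [ae_exists_lt_succs hq] with w hw
      have h1 : (stoppedFails z w m : ℝ) ≤ failsBefore z w :=
        Nat.cast_le.2 (stoppedFails_le_failsBefore (hw z) m)
      have h2 : (stoppedSuccs z w m : ℝ) ≤ ((z + 1 : ℕ) : ℝ) :=
        Nat.cast_le.2 (stoppedSuccs_le_succ z w m)
      have h3 : (0 : ℝ) ≤ stoppedFails z w m := by positivity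
      have h4 : (0 : ℝ) ≤ stoppedSuccs z w m := by positivity
      have h5 := stoppedFails_eq_siteMart hM hz hm w
      push_cast at h2
      rw [Real.norm_of_nonneg (by positivity), ← sq_abs]
      refine pow_le_pow_left₀ (abs_nonneg _) ?_ 2
      rw [abs_le]
      constructor <;> linarith
    · filter_upwards [ae_exists_lt_succs hq] with w hw
      have h1 : Tendsto (fun m => (stoppedFails z w m - stoppedSuccs z w m + δ : ℝ)) atTop
          (𝓝 (failsBefore z w - (z + 1) + δ)) :=
        ((tendsto_stoppedFails (hw z)).sub (tendsto_stoppedSuccs (hw z))).add_const δ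
      have h2 : (failsBefore z w : ℝ) - c = failsBefore z w - (z + 1) + δ := by rw [hc]; ring
      rw [h2]
      refine (h1.pow 2).congr' ?_
      filter_upwards [eventually_ge_atTop M] with m hm
      rw [siteMart, stoppedBias_eq hM hz hm]
  have hlim2 : Tendsto (fun m => ∫ w, siteMart q z w m ^ 2 ∂siteMeasure q) atTop
      (𝓝 (c + (z + 1) - κ)) := by
    have h := ((tendsto_integral_stoppedFails hq hM z).add
      (tendsto_integral_stoppedSuccs hq z)).sub_const κ
    rw [integral_failsBefore hq hM hz] at h
    refine h.congr' ?_
    filter_upwards [eventually_ge_atTop M] with m hm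
    rw [integral_siteMart_sq]
    simp only [stoppedVar_eq hM hz hm]
    have hI : Integrable (fun w => (stoppedFails z w m : ℝ) + stoppedSuccs z w m)
        (siteMeasure q) := (integrable_stoppedFails q z m).add (integrable_stoppedSuccs q z m)
    rw [integral_sub hI (integrable_const _), integral_add (integrable_stoppedFails q z m)
      (integrable_stoppedSuccs q z m)]
    simp [hκ]
  have h1 := tendsto_nhds_unique hlim hlim2
  have h2 : ∫ w, ((failsBefore z w : ℝ) - c) ^ 2 ∂siteMeasure q
      = ∫ w, (failsBefore z w : ℝ) ^ 2 ∂siteMeasure q - 2 * c * c + c ^ 2 := by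
    have h3 : ∀ w, ((failsBefore z w : ℝ) - c) ^ 2
        = (failsBefore z w : ℝ) ^ 2 - 2 * c * failsBefore z w + c ^ 2 := fun w => by ring
    simp only [h3]
    have hI := hF.const_mul (2 * c)
    have hI' : Integrable (fun w => (failsBefore z w : ℝ) ^ 2 - 2 * c * failsBefore z w)
      (siteMeasure q) := hF2.sub hI
    rw [integral_add hI' (integrable_const _), integral_sub hF2 hI, integral_const_mul,
      integral_failsBefore hq hM hz]
    simp [hc, hδ]
  rw [h2] at h1
  linear_combination h1

end

/-- One step of the walk driven by the coins `ω`. The state is the current site together with the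
number of departures from each site; the `k`-th departure from `x` uses the coin `ω x k`. -/
def walkStep (ω : ℤ → ℕ → Bool) (s : ℤ × (ℤ → ℕ)) : ℤ × (ℤ → ℕ) :=
  (if ω s.1 (s.2 s.1) then s.1 + 1 else s.1 - 1, Function.update s.2 s.1 (s.2 s.1 + 1))

/-- The walk started at `0` driven by the coins `ω`, with its departure counts. -/
def walk (ω : ℤ → ℕ → Bool) : ℕ → ℤ × (ℤ → ℕ)
  | 0 => (0, 0)
  | n + 1 => walkStep ω (walk ω n)

section Walk

variable {ω : ℤ → ℕ → Bool}

theorem walk_succ_fst (n : ℕ) : (walk ω (n + 1)).1 =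
    if ω (walk ω n).1 ((walk ω n).2 (walk ω n).1) then (walk ω n).1 + 1 else (walk ω n).1 - 1 :=
  rfl

theorem walk_succ_snd (n : ℕ) : (walk ω (n + 1)).2 =
    Function.update (walk ω n).2 (walk ω n).1 ((walk ω n).2 (walk ω n).1 + 1) :=
  rfl

theorem walk_succ_snd_self (n : ℕ) :
    (walk ω (n + 1)).2 (walk ω n).1 = (walk ω n).2 (walk ω n).1 + 1 := by
  rw [walk_succ_snd, Function.update_self]

theorem walk_succ_snd_of_ne {n : ℕ} {y : ℤ} (h : y ≠ (walk ω n).1) :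
    (walk ω (n + 1)).2 y = (walk ω n).2 y := by
  rw [walk_succ_snd, Function.update_of_ne h]

/-- Conservation of flow through the edge between `y` and `y + 1`. -/
theorem walk_flow (n : ℕ) (y : ℤ) :
    (succs (ω y) ((walk ω n).2 y) : ℤ) + (if 0 > y then 1 else 0)
      = fails (ω (y + 1)) ((walk ω n).2 (y + 1)) + if (walk ω n).1 > y then 1 else 0 := by
  induction n with
  | zero => simp [walk, succs, fails]
  | succ n ih =>
    rw [walk_succ_fst]
    rcases eq_or_ne y (walk ω n).1 with h1 | h1
    · have h2 : y + 1 ≠ (walk ω n).1 := by omega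
      rw [walk_succ_snd_of_ne h2, h1, walk_succ_snd_self, succs_succ]
      rw [h1] at ih
      by_cases hc : ω (walk ω n).1 ((walk ω n).2 (walk ω n).1) = true
      · simp [hc] at ih ⊢; omega
      · simp [hc] at ih ⊢; omega
    · rw [walk_succ_snd_of_ne h1]
      rcases eq_or_ne (y + 1) (walk ω n).1 with h2 | h2
      · rw [h2, walk_succ_snd_self, fails_succ]
        rw [h2] at ih
        by_cases hc : ω (walk ω n).1 ((walk ω n).2 (walk ω n).1) = true
        · simp only [hc, if_true] at ih ⊢; split_ifs at ih ⊢ <;> push_cast at * <;> omega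
        · simp only [hc] at ih ⊢; split_ifs at ih ⊢ <;> push_cast at * <;> omega
      · rw [walk_succ_snd_of_ne h2]
        rw [ih]
        congr 1
        split_ifs <;> first | rfl | omega

theorem sum_departures_le (I : Finset ℤ) (n : ℕ) : ∑ y ∈ I, (walk ω n).2 y ≤ n := by
  induction n with
  | zero => simp [walk]
  | succ n ih =>
    have h : ∀ y, (walk ω (n + 1)).2 y = (walk ω n).2 y + if y = (walk ω n).1 then 1 else 0 := by
      intro y
      split_ifs with h
      · rw [h, walk_succ_snd_self]
      · rw [walk_succ_snd_of_ne h, add_zero]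
    simp only [h, sum_add_distrib, sum_ite_eq']
    split_ifs <;> omega

theorem sum_departures_eq {I : Finset ℤ} {n : ℕ} (hI : ∀ s < n, (walk ω s).1 ∈ I) :
    ∑ y ∈ I, (walk ω n).2 y = n := by
  induction n with
  | zero => simp [walk]
  | succ n ih =>
    have h : ∀ y, (walk ω (n + 1)).2 y = (walk ω n).2 y + if y = (walk ω n).1 then 1 else 0 := by
      intro y
      split_ifs with h
      · rw [h, walk_succ_snd_self]
      · rw [walk_succ_snd_of_ne h, add_zero]
    simp only [h, sum_add_distrib, sum_ite_eq', hI n n.lt_succ_self, if_true,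
      ih fun s hs => hI s (hs.trans n.lt_succ_self)]

theorem departures_eq_card (n : ℕ) (y : ℤ) :
    (walk ω n).2 y = ((range n).filter fun i => (walk ω i).1 = y).card := by
  induction n with
  | zero => simp [walk]
  | succ n ih =>
    rw [range_add_one, filter_insert]
    split_ifs with h
    · rw [card_insert_of_notMem (by simp), ← ih, ← h, walk_succ_snd_self]
    · rw [walk_succ_snd_of_ne (Ne.symm h), ih]

theorem walk_nearest (n : ℕ) : |(walk ω (n + 1)).1 - (walk ω n).1| = 1 := by
  rw [walk_succ_fst]; split_ifs <;> simp

/-- The backward chain below the site `n`: its `j`-th value is the number of steps to the left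
from the site `n - j` before the first visit of `n`. -/
def backChain (ω : ℤ → ℕ → Bool) (n : ℤ) : ℕ → ℕ
  | 0 => 0
  | j + 1 => failsBefore (backChain ω n j) (ω (n - 1 - j))

theorem fails_departures_le_backChain (hω : ∀ y z, ∃ m, z < succs (ω y) m) {n : ℤ} {t : ℕ}
    (ht : ∀ s < t, (walk ω s).1 < n) (j : ℕ) :
    fails (ω (n - j)) ((walk ω t).2 (n - j)) ≤ backChain ω n j := by
  induction t generalizing j with
  | zero => simp [walk, fails]
  | succ t ih =>
    have ih' := ih fun s hs => ht s (hs.trans t.lt_succ_self)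
    have hx := ht t t.lt_succ_self
    rcases ne_or_eq (n - j : ℤ) (walk ω t).1 with h | h
    · rw [walk_succ_snd_of_ne h]; exact ih' j
    obtain _ | i := j
    · simp at h; omega
    rw [h, walk_succ_snd_self, fails_succ]
    by_cases hc : ω (walk ω t).1 ((walk ω t).2 (walk ω t).1) = true
    · have := ih' (i + 1)
      rw [h] at this
      simpa [hc] using this
    have hsite : n - 1 - i = (walk ω t).1 := by push_cast at h; omega
    have hnext : (walk ω t).1 + 1 = n - i := by omega
    have hfl := walk_flow (ω := ω) t (walk ω t).1
    have hi := ih' i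
    rw [hnext] at hfl
    rw [← fails_succ]
    show _ ≤ failsBefore (backChain ω n i) (ω (n - 1 - i))
    rw [hsite]
    refine fails_le_failsBefore (hω _ _) ?_
    rw [succs_succ, if_neg hc]
    rw [if_neg (lt_irrefl _)] at hfl
    split_ifs at hfl <;> omega

theorem backChain_le_fails_departures {n t : ℕ} (ht : (n : ℤ) ≤ (walk ω t).1) {j : ℕ}
    (hj : j ≤ n) : backChain ω n j ≤ fails (ω (n - j)) ((walk ω t).2 (n - j)) := by
  induction j with
  | zero => simp [backChain]
  | succ j ih =>
    have ih' := ih (by omega)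
    have hsite : ((n : ℤ) - (j + 1 : ℕ)) = n - 1 - j := by push_cast; ring
    rw [hsite]
    refine failsBefore_le_fails ?_
    have hfl := walk_flow (ω := ω) t (n - 1 - j)
    have hnext : (n : ℤ) - 1 - j + 1 = n - j := by ring
    rw [hnext, if_neg (by omega), if_pos (by omega)] at hfl
    omega

theorem sum_backChain_le {n t : ℕ} (ht : (n : ℤ) ≤ (walk ω t).1) :
    ∑ j ∈ range n, backChain ω n (j + 1) ≤ t := by
  have hinj : Function.Injective fun j : ℕ => (n : ℤ) - (j + 1 : ℕ) := by
    intro a b h; simpa using h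
  refine le_trans ?_ (sum_departures_le (ω := ω)
    ((range n).image fun j : ℕ => (n : ℤ) - (j + 1 : ℕ)) t)
  rw [sum_image hinj.injOn]
  refine sum_le_sum fun j hj => ?_
  refine (backChain_le_fails_departures ht (mem_range.1 hj)).trans ?_
  exact Nat.le.intro ((add_comm _ _).trans (succs_add_fails _ _))

/-- A walk staying in `(-n, n)` up to time `t` has a large backward chain. -/
theorem le_sum_backChain (hω : ∀ y z, ∃ m, z < succs (ω y) m) {n t : ℕ}
    (ht : ∀ s < t, |(walk ω s).1| < n) :
    t ≤ 2 * ∑ j ∈ range (2 * n + 1), backChain ω n j + (2 * n + 1) := by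
  have hinj : Function.Injective fun j : ℕ => (n : ℤ) - j := by
    intro a b h; simpa using h
  have hsum : ∑ y ∈ (range (2 * n + 1)).image fun j : ℕ => (n : ℤ) - j, (walk ω t).2 y = t := by
    refine sum_departures_eq fun s hs => mem_image.2 ?_
    have := abs_lt.1 (ht s hs)
    exact ⟨((n : ℤ) - (walk ω s).1).toNat, mem_range.2 (by omega), by omega⟩
  rw [sum_image hinj.injOn] at hsum
  have hup := fails_departures_le_backChain hω (n := n) fun s hs => (abs_lt.1 (ht s hs)).2
  have hsite : ∀ j : ℕ, (walk ω t).2 ((n : ℤ) - j)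
      ≤ backChain ω n j + ((if j = 0 then 0 else backChain ω n (j - 1)) + 1) := by
    intro j
    have h1 := hup j
    have h2 := succs_add_fails (ω (n - j)) ((walk ω t).2 (n - j))
    obtain _ | i := j
    · have h3 : (walk ω t).2 ((n : ℤ) - (0 : ℕ)) = 0 := by
        rw [departures_eq_card, card_eq_zero, filter_eq_empty_iff]
        intro i hi hin
        have := abs_lt.1 (ht i (mem_range.1 hi))
        push_cast at hin
        omega
      omega
    · have hfl := walk_flow (ω := ω) t (n - (i + 1 : ℕ))
      have hnext : (n : ℤ) - (i + 1 : ℕ) + 1 = n - i := by push_cast; ring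
      rw [hnext] at hfl
      have h4 := hup i
      simp only [Nat.add_eq_zero_iff, one_ne_zero, and_false, if_false, Nat.add_sub_cancel]
      split_ifs at hfl <;> omega
  calc t = _ := hsum.symm
    _ ≤ ∑ j ∈ range (2 * n + 1), (backChain ω n j
        + ((if j = 0 then 0 else backChain ω n (j - 1)) + 1)) := sum_le_sum fun j _ => hsite j
    _ ≤ _ := by
      rw [sum_add_distrib, sum_add_distrib]
      have : ∑ j ∈ range (2 * n + 1), (if j = 0 then 0 else backChain ω n (j - 1))
          ≤ ∑ j ∈ range (2 * n + 1), backChain ω n j := by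
        rw [sum_range_succ']
        simp only [Nat.add_eq_zero_iff, one_ne_zero, and_false, if_false, Nat.add_sub_cancel,
          if_true, add_zero]
        exact sum_le_sum_of_subset (range_subset_range.2 (by omega))
      simp only [sum_const, card_range, smul_eq_mul, mul_one]
      omega

end Walk

/-- Law of the coins of all sites. -/
def envMeasure (q : ℕ → unitInterval) : Measure (ℤ → ℕ → Bool) :=
  Measure.infinitePi fun _ => siteMeasure q

instance (q : ℕ → unitInterval) : IsProbabilityMeasure (envMeasure q) := by
  unfold envMeasure; infer_instance

/-- Resampling one coin of one site leaves the law of the coins invariant. -/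
theorem lintegral_envMeasure_update (q : ℕ → unitInterval) (x : ℤ) (m : ℕ)
    {f : (ℤ → ℕ → Bool) → ℝ≥0∞} (hf : Measurable f) :
    ∫⁻ ω, f ω ∂envMeasure q
      = ∫⁻ ω, ∫⁻ b, f (Function.update ω x (Function.update (ω x) m b))
          ∂bernoulliMeasure true false (q m) ∂envMeasure q := by
  have hmeas : Measurable fun a : (ℤ → ℕ → Bool) × Bool =>
      f (Function.update a.1 x (Function.update (a.1 x) m a.2)) := by
    have h0 : Measurable fun a : (ℤ → ℕ → Bool) × Bool => (a.1 x, a.2) :=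
      ((measurable_pi_apply x).comp measurable_fst).prodMk measurable_snd
    have h : Measurable fun a : (ℤ → ℕ → Bool) × Bool => Function.update (a.1 x) m a.2 :=
      (measurable_update_pair (E := fun _ : ℕ => Bool) m).comp h0
    exact hf.comp ((measurable_update_pair (E := fun _ : ℤ => ℕ → Bool) x).comp
      (measurable_fst.prodMk h))
  unfold envMeasure
  rw [lintegral_infinitePi_update _ x hf,
    lintegral_infinitePi_update _ x hmeas.lintegral_prod_right']
  refine lintegral_congr fun ω => ?_
  have hf' : Measurable fun w : ℕ → Bool => f (Function.update ω x w) :=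
    hf.comp ((measurable_update_pair x).comp (measurable_const.prodMk measurable_id))
  conv_lhs => rw [siteMeasure, lintegral_infinitePi_update _ m hf']
  simp only [Function.update_self, Function.update_idem]
  rfl

theorem measurable_eval_countable {ι β : Type*} [Countable ι] [MeasurableSpace ι]
    [MeasurableSingletonClass ι] [MeasurableSpace β] :
    Measurable fun a : (ι → β) × ι => a.1 a.2 :=
  measurable_from_prod_countable_left fun i => measurable_pi_apply i

theorem measurable_walk (n : ℕ) : Measurable fun ω => walk ω n := by
  induction n with
  | zero => exact measurable_const
  | succ n ih =>
    have h1 : Measurable fun ω => (walk ω n).1 := measurable_fst.comp ih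
    have h2 : Measurable fun ω => (walk ω n).2 := measurable_snd.comp ih
    have h3 : Measurable fun ω => (walk ω n).2 (walk ω n).1 :=
      measurable_eval_countable.comp (h2.prodMk h1)
    have h4 : Measurable fun ω : ℤ → ℕ → Bool => ω (walk ω n).1 ((walk ω n).2 (walk ω n).1) :=
      measurable_eval_countable.comp
        ((measurable_eval_countable.comp (measurable_id.prodMk h1)).prodMk h3)
    refine Measurable.prodMk ?_ ?_
    · exact (measurable_of_countable fun a : Bool × ℤ => if a.1 then a.2 + 1 else a.2 - 1).comp
        (h4.prodMk h1)
    · refine measurable_pi_lambda _ fun y => ?_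
      have h5 : Measurable fun ω => (walk ω n).2 y := (measurable_pi_apply y).comp h2
      have h6 := (measurable_of_countable fun a : ℤ × ℕ × ℕ => if y = a.1 then a.2.1 + 1
        else a.2.2).comp (h1.prodMk (h3.prodMk h5))
      convert h6 using 2 with ω
      simp [Function.update_apply]

theorem measurable_walk_fst (n : ℕ) : Measurable fun ω => (walk ω n).1 :=
  measurable_fst.comp (measurable_walk n)

theorem measurable_backChain (n : ℤ) (j : ℕ) : Measurable fun ω => backChain ω n j := by
  induction j with
  | zero => exact measurable_const
  | succ j ih => exact measurable_failsBefore_uncurry.comp (ih.prodMk (measurable_pi_apply _))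

theorem backChain_update (ω : ℤ → ℕ → Bool) (n : ℤ) {j i : ℕ} (h : j ≤ i) (w : ℕ → Bool) :
    backChain (Function.update ω (n - 1 - i) w) n j = backChain ω n j := by
  induction j with
  | zero => rfl
  | succ j ih =>
    rw [backChain, backChain, ih (by omega), Function.update_of_ne (by omega)]

/-- Transition operator of the backward chain. -/
def backOp (q : ℕ → unitInterval) (f : ℕ → ℝ≥0∞) (z : ℕ) : ℝ≥0∞ :=
  ∫⁻ w, f (failsBefore z w) ∂siteMeasure q

theorem lintegral_backChain_succ (q : ℕ → unitInterval) (f : ℕ → ℝ≥0∞) (n : ℤ) (j : ℕ) :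
    ∫⁻ ω, f (backChain ω n (j + 1)) ∂envMeasure q
      = ∫⁻ ω, backOp q f (backChain ω n j) ∂envMeasure q := by
  have hf : Measurable fun ω => f (backChain ω n (j + 1)) :=
    (measurable_of_countable f).comp (measurable_backChain n (j + 1))
  unfold envMeasure
  rw [lintegral_infinitePi_update _ (n - 1 - j) hf]
  refine lintegral_congr fun ω => lintegral_congr fun w => ?_
  rw [backChain, backChain_update ω n le_rfl, Function.update_self]

theorem lintegral_backChain (q : ℕ → unitInterval) (f : ℕ → ℝ≥0∞) (n : ℤ) (j : ℕ) :
    ∫⁻ ω, f (backChain ω n j) ∂envMeasure q = (backOp q)^[j] f 0 := by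
  induction j generalizing f with
  | zero => simp [backChain]
  | succ j ih => rw [lintegral_backChain_succ, ih, Function.iterate_succ_apply]

theorem ae_envMeasure_exists_lt_succs {q : ℕ → unitInterval} (hq : ∀ i, 1 / 2 ≤ (q i : ℝ)) :
    ∀ᵐ ω ∂envMeasure q, ∀ y z, ∃ m, z < succs (ω y) m := by
  rw [ae_all_iff]
  intro y
  exact (measurePreserving_eval_infinitePi (fun _ : ℤ => siteMeasure q) y).quasiMeasurePreserving.ae
    (ae_exists_lt_succs hq)

theorem walk_update_eq {ω : ℤ → ℕ → Bool} {n : ℕ} {x : ℕ → ℤ}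
    (h : ∀ k ≤ n, (walk ω k).1 = x k) (b : Bool) {k : ℕ} (hk : k ≤ n) :
    walk (Function.update ω (x n) (Function.update (ω (x n))
      ((range n).filter fun i => x i = x n).card b)) k = walk ω k := by
  induction k with
  | zero => rfl
  | succ k ih =>
    have ih' := ih (by omega)
    have hcoin : (Function.update ω (x n) (Function.update (ω (x n))
        ((range n).filter fun i => x i = x n).card b)) (x k) ((walk ω k).2 (x k))
        = ω (x k) ((walk ω k).2 (x k)) := by
      rcases eq_or_ne (x k) (x n) with hx | hx
      · rw [hx, Function.update_self, Function.update_of_ne]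
        refine ne_of_lt ?_
        rw [departures_eq_card]
        refine card_lt_card ⟨?_, fun hsub => ?_⟩
        · intro i hi
          rw [mem_filter, mem_range] at hi ⊢
          exact ⟨by omega, by rw [← h i (by omega)]; exact hi.2⟩
        · have := hsub (mem_filter.2 ⟨mem_range.2 (by omega : k < n), hx⟩)
          simp at this
      · rw [Function.update_of_ne hx]
    rw [walk, walk, ih', walkStep, walkStep, h k (by omega), hcoin]

theorem walk_update_iff {ω : ℤ → ℕ → Bool} {n : ℕ} {x : ℕ → ℤ} (b : Bool) :
    (∀ k ≤ n, (walk (Function.update ω (x n) (Function.update (ω (x n))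
      ((range n).filter fun i => x i = x n).card b)) k).1 = x k)
      ↔ ∀ k ≤ n, (walk ω k).1 = x k := by
  constructor
  · intro h k hk
    have := walk_update_eq h (ω (x n) ((range n).filter fun i => x i = x n).card) hk
    rw [Function.update_self, Function.update_idem, Function.update_idem,
      Function.update_eq_self, Function.update_eq_self] at this
    rw [this, h k hk]
  · intro h k hk
    rw [walk_update_eq h b hk, h k hk]

theorem measurableSet_path {Ω : Type*} [MeasurableSpace Ω] {X : ℕ → Ω → ℤ}
    (hX : ∀ n, Measurable (X n)) (n : ℕ) (x : ℕ → ℤ) :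
    MeasurableSet {ω | ∀ k ≤ n, X k ω = x k} := by
  have : {ω | ∀ k ≤ n, X k ω = x k} = ⋂ k, ⋂ (_ : k ≤ n), X k ⁻¹' {x k} := by
    ext; simp
  rw [this]
  exact MeasurableSet.iInter fun k => MeasurableSet.iInter fun _ =>
    hX k (measurableSet_singleton _)

/-- The walk driven by independent coins is a cookie random walk. -/
theorem isCookieRW_walk {M : ℕ} {p : Fin M → ℝ} {q : ℕ → unitInterval}
    (hq : ∀ i, (q i : ℝ) = strength M p (i + 1)) :
    IsCookieRW M p (envMeasure q) fun n ω => (walk ω n).1 where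
  isProb := inferInstance
  meas := measurable_walk_fst
  init := by simp [walk]
  nearest := by simp [walk_nearest]
  step n x := by
    set m := ((range n).filter fun i => x i = x n).card with hm
    have hcard : ((range (n + 1)).filter fun i => x i = x n).card = m + 1 := by
      rw [range_add_one, filter_insert, if_pos rfl, card_insert_of_notMem (by simp)]
    have hA := measurableSet_path measurable_walk_fst n x
    have hB : MeasurableSet {ω : ℤ → ℕ → Bool | ω (x n) m = true} :=
      measurableSet_eq_fun ((measurable_pi_apply m).comp (measurable_pi_apply (x n)))
        measurable_const
    have hset : {ω | (∀ k ≤ n, (walk ω k).1 = x k) ∧ (walk ω (n + 1)).1 = x n + 1}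
        = {ω | ∀ k ≤ n, (walk ω k).1 = x k} ∩ {ω | ω (x n) m = true} := by
      ext ω
      simp only [Set.mem_ofPred_eq, Set.mem_inter_iff]
      refine and_congr_right fun h => ?_
      have hdep : (walk ω n).2 (walk ω n).1 = m := by
        rw [departures_eq_card, hm, h n le_rfl]
        congr 1
        exact filter_congr fun i hi => by rw [h i (mem_range.1 hi).le]
      rw [walk_succ_fst, hdep, h n le_rfl]
      split_ifs with hc
      · simp [hc]
      · exact iff_of_false (by omega) hc
    rw [hcard, ← hq, hset, ← lintegral_indicator_one (hA.inter hB),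
      lintegral_envMeasure_update q (x n) m (measurable_one.indicator (hA.inter hB)), mul_comm,
      ← lintegral_indicator_one hA, ← lintegral_mul_const _ (measurable_one.indicator hA)]
    refine lintegral_congr fun ω => ?_
    by_cases hω : ω ∈ {ω | ∀ k ≤ n, (walk ω k).1 = x k}
    · have : ∀ b, ({ω | ∀ k ≤ n, (walk ω k).1 = x k} ∩ {ω | ω (x n) m = true}).indicator
          (1 : (ℤ → ℕ → Bool) → ℝ≥0∞) (Function.update ω (x n) (Function.update (ω (x n)) m b))
          = ({true} : Set Bool).indicator 1 b := by
        intro b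
        have h1 : (Function.update ω (x n) (Function.update (ω (x n)) m b))
            ∈ {ω | ∀ k ≤ n, (walk ω k).1 = x k} := (walk_update_iff b).2 hω
        cases b <;> simp [Set.indicator, h1, -Set.mem_ofPred_eq] <;> simp
      simp only [this, Set.indicator_of_mem hω, Pi.one_apply, one_mul]
      rw [lintegral_indicator_one (measurableSet_singleton _),
        bernoulliMeasure_apply_of_mem_of_notMem _ (measurableSet_singleton _) (by simp) (by simp)]
      rw [ENNReal.ofReal, Real.toNNReal_of_nonneg (q m).2.1]
      rfl
    · have : ∀ b, ({ω | ∀ k ≤ n, (walk ω k).1 = x k} ∩ {ω | ω (x n) m = true}).indicator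
          (1 : (ℤ → ℕ → Bool) → ℝ≥0∞) (Function.update ω (x n) (Function.update (ω (x n)) m b))
          = 0 := by
        intro b
        exact Set.indicator_of_notMem (fun h => hω ((walk_update_iff b).1 h.1)) _
      simp [this, Set.indicator_of_notMem hω]

section Law

variable {Ω : Type*} [MeasurableSpace Ω] {M : ℕ} {p : Fin M → ℝ} {P : Measure Ω} {X : ℕ → Ω → ℤ}

theorem IsCookieRW.ae_zero (hX : IsCookieRW M p P X) : ∀ᵐ ω ∂P, X 0 ω = 0 := by
  have := hX.isProb
  exact (mem_ae_iff_prob_eq_one (hX.meas 0 (measurableSet_singleton 0))).2 hX.init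

theorem IsCookieRW.ae_nearest (hX : IsCookieRW M p P X) :
    ∀ᵐ ω ∂P, ∀ n, |X (n + 1) ω - X n ω| = 1 := by
  have := hX.isProb
  refine (mem_ae_iff_prob_eq_one ?_).2 hX.nearest
  rw [Set.ofPred_forall]
  refine MeasurableSet.iInter fun n => ?_
  have h : Measurable fun ω => |X (n + 1) ω - X n ω| :=
    (measurable_of_countable fun a : ℤ × ℤ => |a.1 - a.2|).comp
      ((hX.meas (n + 1)).prodMk (hX.meas n))
  exact h (measurableSet_singleton 1)

theorem IsCookieRW.measure_path_succ (hX : IsCookieRW M p P X) (n : ℕ) (x : ℕ → ℤ) :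
    P {ω | ∀ k ≤ n + 1, X k ω = x k}
      = if x (n + 1) = x n + 1 then
          ENNReal.ofReal (strength M p (((range (n + 1)).filter fun i => x i = x n).card))
            * P {ω | ∀ k ≤ n, X k ω = x k}
        else if x (n + 1) = x n - 1 then P {ω | ∀ k ≤ n, X k ω = x k}
          - ENNReal.ofReal (strength M p (((range (n + 1)).filter fun i => x i = x n).card))
            * P {ω | ∀ k ≤ n, X k ω = x k}
        else 0 := by
  have := hX.isProb
  have hsucc : ∀ ω, (∀ k ≤ n + 1, X k ω = x k)
      ↔ (∀ k ≤ n, X k ω = x k) ∧ X (n + 1) ω = x (n + 1) := by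
    intro ω
    refine ⟨fun h => ⟨fun k hk => h k (by omega), h _ le_rfl⟩, fun h k hk => ?_⟩
    rcases Nat.lt_or_ge n k with h1 | h1
    · obtain rfl : k = n + 1 := by omega
      exact h.2
    · exact h.1 k h1
  have hmeas : MeasurableSet {ω | (∀ k ≤ n, X k ω = x k) ∧ X (n + 1) ω = x n + 1} :=
    (measurableSet_path hX.meas n x).inter (hX.meas (n + 1) (measurableSet_singleton _))
  rw [← hX.step n x]
  split_ifs with h1 h2
  · simp only [hsucc, h1]
  · have hsub : {ω | (∀ k ≤ n, X k ω = x k) ∧ X (n + 1) ω = x n + 1}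
        ⊆ {ω | ∀ k ≤ n, X k ω = x k} := fun ω h => h.1
    rw [← measure_sdiff hsub hmeas.nullMeasurableSet (measure_ne_top _ _)]
    refine measure_congr ?_
    filter_upwards [hX.ae_nearest] with ω hω
    refine propext ?_
    show (∀ k ≤ n + 1, X k ω = x k) ↔ (∀ k ≤ n, X k ω = x k)
      ∧ ¬ ((∀ k ≤ n, X k ω = x k) ∧ X (n + 1) ω = x n + 1)
    rw [hsucc]
    constructor
    · exact fun h => ⟨h.1, fun h' => by omega⟩
    · rintro ⟨h3, h4⟩
      refine ⟨h3, ?_⟩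
      have h5 := hω n
      have h6 : X (n + 1) ω ≠ x n + 1 := fun h => h4 ⟨h3, h⟩
      rw [h3 n le_rfl] at h5
      rcases (abs_eq zero_le_one).1 h5 with h | h <;> omega
  · rw [measure_eq_zero_iff_ae_notMem]
    filter_upwards [hX.ae_nearest] with ω hω h
    have h5 := hω n
    rw [h n (by omega), h (n + 1) le_rfl] at h5
    rcases (abs_eq zero_le_one).1 h5 with h | h <;> omega

variable {Ω' : Type*} [MeasurableSpace Ω'] {P' : Measure Ω'} {Y : ℕ → Ω' → ℤ}

theorem IsCookieRW.measure_path_eq (hX : IsCookieRW M p P X) (hY : IsCookieRW M p P' Y)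
    (n : ℕ) (x : ℕ → ℤ) : P {ω | ∀ k ≤ n, X k ω = x k} = P' {ω | ∀ k ≤ n, Y k ω = x k} := by
  induction n with
  | zero =>
    have := hX.isProb
    have := hY.isProb
    have h1 : P {ω | ∀ k ≤ 0, X k ω = x k} = P {_ω | x 0 = 0} := by
      refine measure_congr ?_
      filter_upwards [hX.ae_zero] with ω hω
      refine propext ?_
      show (∀ k ≤ 0, X k ω = x k) ↔ x 0 = 0
      simp [hω, eq_comm]
    have h2 : P' {ω | ∀ k ≤ 0, Y k ω = x k} = P' {_ω | x 0 = 0} := by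
      refine measure_congr ?_
      filter_upwards [hY.ae_zero] with ω hω
      refine propext ?_
      show (∀ k ≤ 0, Y k ω = x k) ↔ x 0 = 0
      simp [hω, eq_comm]
    rw [h1, h2]
    by_cases h : x 0 = 0 <;> simp [h]
  | succ n ih => rw [hX.measure_path_succ, hY.measure_path_succ, ih]

/-- Two cookie random walks with the same parameters have the same finite-dimensional laws. -/
theorem IsCookieRW.measure_eq (hX : IsCookieRW M p P X) (hY : IsCookieRW M p P' Y)
    (n : ℕ) (S : Set (Fin (n + 1) → ℤ)) :
    P {ω | (fun k : Fin (n + 1) => X k ω) ∈ S} = P' {ω | (fun k : Fin (n + 1) => Y k ω) ∈ S} := by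
  have hXm : Measurable fun ω (k : Fin (n + 1)) => X k ω :=
    measurable_pi_lambda _ fun k => hX.meas k
  have hYm : Measurable fun ω (k : Fin (n + 1)) => Y k ω :=
    measurable_pi_lambda _ fun k => hY.meas k
  have hmap : P.map (fun ω (k : Fin (n + 1)) => X k ω)
      = P'.map (fun ω (k : Fin (n + 1)) => Y k ω) := by
    refine Measure.ext_of_singleton fun a => ?_
    rw [Measure.map_apply hXm (measurableSet_singleton a),
      Measure.map_apply hYm (measurableSet_singleton a)]
    convert hX.measure_path_eq hY n (fun k => if h : k < n + 1 then a ⟨k, h⟩ else 0) using 2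
    all_goals
      ext ω
      simp only [Set.mem_preimage, Set.mem_singleton_iff, Set.mem_ofPred_eq, funext_iff]
      constructor
      · intro h k hk
        rw [dif_pos (Nat.lt_succ_of_le hk)]
        exact h ⟨k, _⟩
      · intro h k
        have := h k (Nat.le_of_lt_succ k.2)
        rwa [dif_pos k.2] at this
  have h := DFunLike.congr_fun hmap S
  rwa [Measure.map_apply hXm S.to_countable.measurableSet,
    Measure.map_apply hYm S.to_countable.measurableSet] at h

theorem half_le_strength (hp : ∀ i, 1 / 2 ≤ p i) (i : ℕ) : 1 / 2 ≤ strength M p i := by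
  unfold strength
  split_ifs
  · exact hp _
  · exact le_rfl

theorem IsCookieRW.half_le_measure_up (hX : IsCookieRW M p P X) (hp : ∀ i, 1 / 2 ≤ p i) (n : ℕ) :
    1 / 2 ≤ P.real {ω | X (n + 1) ω = X n ω + 1} := by
  have := hX.isProb
  have hXm : Measurable fun ω (k : Fin (n + 1)) => X k ω :=
    measurable_pi_lambda _ fun k => hX.meas k
  have hup : MeasurableSet {ω | X (n + 1) ω = X n ω + 1} := measurableSet_eq_fun (hX.meas _)
    ((measurable_of_countable fun a : ℤ => a + 1).comp (hX.meas n))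
  have hle : ∀ a : Fin (n + 1) → ℤ,
      ENNReal.ofReal (1 / 2) * P ((fun ω (k : Fin (n + 1)) => X k ω) ⁻¹' {a})
        ≤ P.restrict {ω | X (n + 1) ω = X n ω + 1}
          ((fun ω (k : Fin (n + 1)) => X k ω) ⁻¹' {a}) := by
    intro a
    rw [Measure.restrict_apply (hXm (measurableSet_singleton a))]
    have hx : ∀ ω, ω ∈ (fun ω (k : Fin (n + 1)) => X k ω) ⁻¹' {a}
        ↔ ∀ k ≤ n, X k ω = (fun k => if h : k < n + 1 then a ⟨k, h⟩ else 0) k := by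
      intro ω
      simp only [Set.mem_preimage, Set.mem_singleton_iff, funext_iff]
      constructor
      · intro h k hk
        rw [dif_pos (Nat.lt_succ_of_le hk)]
        exact h ⟨k, _⟩
      · intro h k
        have := h k (Nat.le_of_lt_succ k.2)
        rwa [dif_pos k.2] at this
    generalize (fun k => if h : k < n + 1 then a ⟨k, h⟩ else 0) = x at hx
    have h1 : (fun ω (k : Fin (n + 1)) => X k ω) ⁻¹' {a} = {ω | ∀ k ≤ n, X k ω = x k} :=
      Set.ext hx
    have h2 : {ω | ∀ k ≤ n, X k ω = x k} ∩ {ω | X (n + 1) ω = X n ω + 1}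
        = {ω | (∀ k ≤ n, X k ω = x k) ∧ X (n + 1) ω = x n + 1} := by
      ext ω
      exact and_congr_right fun h => by rw [Set.mem_ofPred_eq, h n le_rfl]
    rw [h1, h2, hX.step]
    gcongr
    exact half_le_strength hp _
  have hsum := ENNReal.tsum_le_tsum hle
  rw [ENNReal.tsum_mul_left] at hsum
  have huniv : ∀ μ : Measure Ω, ∑' a, μ ((fun ω (k : Fin (n + 1)) => X k ω) ⁻¹' {a})
      = μ Set.univ := by
    intro μ
    have h := tsum_measure_preimage_singleton (μ := μ) (s := (Set.univ : Set (Fin (n + 1) → ℤ)))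
      (Set.to_countable _) (f := fun ω (k : Fin (n + 1)) => X k ω)
      fun a _ => hXm (measurableSet_singleton a)
    rw [Set.preimage_univ] at h
    rw [← h]
    exact ((Equiv.Set.univ _).tsum_eq
      (fun a => μ ((fun ω (k : Fin (n + 1)) => X k ω) ⁻¹' {a}))).symm
  rw [huniv, huniv, measure_univ, mul_one, Measure.restrict_apply_univ] at hsum
  exact (ENNReal.ofReal_le_iff_le_toReal (measure_ne_top _ _)).1 hsum

theorem IsCookieRW.ae_abs_le (hX : IsCookieRW M p P X) : ∀ᵐ ω ∂P, ∀ n, |(X n ω : ℝ)| ≤ n := by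
  filter_upwards [hX.ae_zero, hX.ae_nearest] with ω h0 h1 n
  induction n with
  | zero => simp [h0]
  | succ n ih =>
    have h2 : |(X (n + 1) ω : ℝ) - X n ω| = 1 := by exact_mod_cast h1 n
    rw [abs_le] at ih ⊢
    push_cast
    rcases (abs_eq zero_le_one).1 h2 with h | h <;> constructor <;> linarith

theorem IsCookieRW.measurable_real (hX : IsCookieRW M p P X) (n : ℕ) :
    Measurable fun ω => (X n ω : ℝ) :=
  (measurable_of_countable fun a : ℤ => (a : ℝ)).comp (hX.meas n)

theorem IsCookieRW.integrable (hX : IsCookieRW M p P X) (n : ℕ) :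
    Integrable (fun ω => (X n ω : ℝ)) P := by
  have := hX.isProb
  refine Integrable.of_bound (hX.measurable_real n).aestronglyMeasurable n ?_
  filter_upwards [hX.ae_abs_le] with ω h
  exact h n

theorem IsCookieRW.integral_nonneg (hX : IsCookieRW M p P X) (hp : ∀ i, 1 / 2 ≤ p i) (n : ℕ) :
    0 ≤ ∫ ω, (X n ω : ℝ) ∂P := by
  have := hX.isProb
  induction n with
  | zero =>
    rw [integral_congr_ae (g := fun _ => (0 : ℝ))]
    · simp
    · filter_upwards [hX.ae_zero] with ω h
      simp [h]
  | succ n ih =>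
    have hup : MeasurableSet {ω | X (n + 1) ω = X n ω + 1} := measurableSet_eq_fun (hX.meas _)
      ((measurable_of_countable fun a : ℤ => a + 1).comp (hX.meas n))
    have hind : Integrable (fun ω => {ω | X (n + 1) ω = X n ω + 1}.indicator (1 : Ω → ℝ) ω) P :=
      (integrable_const (1 : ℝ)).indicator hup
    have heq : ∫ ω, (X (n + 1) ω : ℝ) ∂P = ∫ ω, ((X n ω : ℝ)
        + (2 * {ω | X (n + 1) ω = X n ω + 1}.indicator (1 : Ω → ℝ) ω - 1)) ∂P := by
      refine integral_congr_ae ?_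
      filter_upwards [hX.ae_nearest] with ω h
      rcases (abs_eq zero_le_one).1 (h n) with h | h
      · have h1 : ω ∈ {ω | X (n + 1) ω = X n ω + 1} := by
          rw [Set.mem_ofPred_eq]; omega
        simp only [Set.indicator_of_mem h1, Pi.one_apply]
        rw [h1]
        push_cast
        ring
      · have h1 : ω ∉ {ω | X (n + 1) ω = X n ω + 1} := by
          rw [Set.mem_ofPred_eq]; omega
        simp only [Set.indicator_of_notMem h1]
        have h2 : X (n + 1) ω = X n ω - 1 := by omega
        rw [h2]
        push_cast
        ring
    have hind2 : Integrable (fun ω =>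
        2 * {ω | X (n + 1) ω = X n ω + 1}.indicator (1 : Ω → ℝ) ω - 1) P :=
      (hind.const_mul 2).sub (integrable_const 1)
    rw [heq, integral_add (hX.integrable n) hind2,
      integral_sub (hind.const_mul 2) (integrable_const 1), integral_const_mul]
    have := hX.half_le_measure_up hp n
    rw [integral_indicator_one hup]
    simp only [integral_const, probReal_univ, smul_eq_mul, mul_one]
    linarith

theorem IsCookieRW.speed_nonneg (hX : IsCookieRW M p P X) (hp : ∀ i, 1 / 2 ≤ p i) {v : ℝ}
    (hv : ∀ᵐ ω ∂P, Tendsto (fun n => (X n ω : ℝ) / n) atTop (𝓝 v)) : 0 ≤ v := by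
  have := hX.isProb
  have hlim : Tendsto (fun n : ℕ => ∫ ω, (X n ω : ℝ) / n ∂P) atTop (𝓝 (∫ _, v ∂P)) := by
    refine tendsto_integral_of_dominated_convergence (fun _ => 1)
      (fun n => ((hX.measurable_real n).div_const _).aestronglyMeasurable)
      (integrable_const _) (fun n => ?_) hv
    filter_upwards [hX.ae_abs_le] with ω h
    rw [norm_div, Real.norm_eq_abs, Real.norm_natCast]
    exact div_le_one_of_le₀ (h n) (Nat.cast_nonneg n)
  simp only [integral_const, probReal_univ, smul_eq_mul, one_mul] at hlim
  refine ge_of_tendsto' hlim fun n => ?_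
  rw [integral_div]
  exact div_nonneg (hX.integral_nonneg hp n) (Nat.cast_nonneg n)

end Law

theorem backOp_ofReal {q : ℕ → unitInterval} {g : ℕ → ℝ} {z : ℕ} (hg : ∀ y, 0 ≤ g y)
    (hi : Integrable (fun w => g (failsBefore z w)) (siteMeasure q)) :
    backOp q (fun y => ENNReal.ofReal (g y)) z
      = ENNReal.ofReal (∫ w, g (failsBefore z w) ∂siteMeasure q) :=
  (ofReal_integral_eq_lintegral_ofReal hi (ae_of_all _ fun _ => hg _)).symm

theorem prob_tendsto_one_of_ae_eventually {Ω : Type*} [MeasurableSpace Ω] {P : Measure Ω}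
    [IsProbabilityMeasure P] {A : ℕ → Set Ω} (hA : ∀ n, MeasurableSet (A n))
    (h : ∀ᵐ ω ∂P, ∀ᶠ n in atTop, ω ∈ A n) : Tendsto (fun n => P (A n)) atTop (𝓝 1) := by
  rw [← measure_univ (μ := P)]
  refine tendsto_measure_of_ae_tendsto_indicator_of_isFiniteMeasure atTop MeasurableSet.univ hA ?_
  filter_upwards [h] with ω hω
  filter_upwards [hω] with n hn
  exact iff_of_true hn trivial

section Transient

variable {q : ℕ → unitInterval} (hq : ∀ i, 1 / 2 ≤ (q i : ℝ)) {M : ℕ}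
  (hM : ∀ i, M ≤ i → (q i : ℝ) = 1 / 2)

include hq hM

/-- Foster–Lyapunov drift inequality for the backward chain when the total bias exceeds `2`. -/
theorem backOp_sq_drift (hδ : 2 < ∑ i ∈ range M, (2 * (q i : ℝ) - 1)) :
    ∃ c C : ℝ, 0 < c ∧ ∀ z : ℕ, backOp q (fun y => ENNReal.ofReal ((y : ℝ) ^ 2)) z
      + ENNReal.ofReal c * z ≤ ENNReal.ofReal ((z : ℝ) ^ 2) + ENNReal.ofReal C := by
  set δ : ℝ := ∑ i ∈ range M, (2 * (q i : ℝ) - 1) with hδ_def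
  set κ : ℝ := ∑ i ∈ range M, (2 * (q i : ℝ) - 1) ^ 2 with hκ_def
  have hnn : ∀ z : ℕ, 0 ≤ ∫ w, (failsBefore z w : ℝ) ^ 2 ∂siteMeasure q + 2 * (δ - 2) * z :=
    fun z => add_nonneg (integral_nonneg fun w => by positivity)
      (mul_nonneg (by linarith) (Nat.cast_nonneg z))
  set C := |(1 - δ) ^ 2 + 2 - δ - κ|
    + ∑ z ∈ range M, (∫ w, (failsBefore z w : ℝ) ^ 2 ∂siteMeasure q + 2 * (δ - 2) * z) with hC
  have hsum : 0 ≤ ∑ z ∈ range M, (∫ w, (failsBefore z w : ℝ) ^ 2 ∂siteMeasure q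
      + 2 * (δ - 2) * z) := sum_nonneg fun z _ => hnn z
  have hC0 : 0 ≤ C := add_nonneg (abs_nonneg _) hsum
  refine ⟨2 * (δ - 2), C, by linarith, fun z => ?_⟩
  have hreal : ∫ w, (failsBefore z w : ℝ) ^ 2 ∂siteMeasure q + 2 * (δ - 2) * z
      ≤ (z : ℝ) ^ 2 + C := by
    rcases Nat.lt_or_ge z M with hz | hz
    · have h1 := single_le_sum (f := fun z : ℕ =>
        ∫ w, (failsBefore z w : ℝ) ^ 2 ∂siteMeasure q + 2 * (δ - 2) * z)
        (fun z _ => hnn z) (mem_range.2 hz)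
      have h2 := abs_nonneg ((1 - δ) ^ 2 + 2 - δ - κ)
      nlinarith [sq_nonneg (z : ℝ)]
    · rw [integral_failsBefore_sq hq hM hz]
      have h2 := le_abs_self ((1 - δ) ^ 2 + 2 - δ - κ)
      nlinarith
  rw [backOp_ofReal (g := fun y => (y : ℝ) ^ 2) (fun y => by positivity)
      (integrable_failsBefore_sq hq hM z), ← ENNReal.ofReal_natCast z,
    ← ENNReal.ofReal_mul (by linarith),
    ← ENNReal.ofReal_add (integral_nonneg fun w => by positivity)
      (mul_nonneg (by linarith) (Nat.cast_nonneg z)), ← ENNReal.ofReal_add (by positivity) hC0]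
  exact ENNReal.ofReal_le_ofReal hreal

theorem exists_sum_lintegral_backChain_le (hδ : 2 < ∑ i ∈ range M, (2 * (q i : ℝ) - 1)) :
    ∃ D : ℕ, ∀ (x : ℤ) (n : ℕ),
      ∑ j ∈ range n, ∫⁻ ω, backChain ω x j ∂envMeasure q ≤ D * n := by
  obtain ⟨c, C, hc, hcC⟩ := backOp_sq_drift hq hM hδ
  obtain ⟨D, hD⟩ := exists_nat_ge (C / c)
  refine ⟨D, fun x n => ?_⟩
  have hstep : ∀ n : ℕ, ∫⁻ ω, ENNReal.ofReal ((backChain ω x n : ℝ) ^ 2) ∂envMeasure q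
      + ENNReal.ofReal c * ∑ j ∈ range n, ∫⁻ ω, backChain ω x j ∂envMeasure q
      ≤ ENNReal.ofReal C * n := by
    intro n
    induction n with
    | zero => simp [backChain]
    | succ n ih =>
      have h1 : ∫⁻ ω, ENNReal.ofReal ((backChain ω x (n + 1) : ℝ) ^ 2) ∂envMeasure q
          + ENNReal.ofReal c * ∫⁻ ω, backChain ω x n ∂envMeasure q
          ≤ ∫⁻ ω, ENNReal.ofReal ((backChain ω x n : ℝ) ^ 2) ∂envMeasure q
            + ENNReal.ofReal C := by
        have hm : Measurable fun ω => (backChain ω x n : ℝ≥0∞) :=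
          (measurable_of_countable fun k : ℕ => (k : ℝ≥0∞)).comp (measurable_backChain x n)
        have hm2 : Measurable fun ω => ENNReal.ofReal ((backChain ω x n : ℝ) ^ 2) :=
          (measurable_of_countable fun k : ℕ => ENNReal.ofReal ((k : ℝ) ^ 2)).comp
            (measurable_backChain x n)
        rw [lintegral_backChain_succ q (fun y => ENNReal.ofReal ((y : ℝ) ^ 2)),
          ← lintegral_const_mul _ hm, ← lintegral_add_right _ (hm.const_mul _)]
        refine (lintegral_mono fun ω => hcC (backChain ω x n)).trans ?_
        rw [lintegral_add_left hm2]
        simp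
      rw [sum_range_succ, mul_add]
      calc _ = (∫⁻ ω, ENNReal.ofReal ((backChain ω x (n + 1) : ℝ) ^ 2) ∂envMeasure q
          + ENNReal.ofReal c * ∫⁻ ω, backChain ω x n ∂envMeasure q)
          + ENNReal.ofReal c * ∑ j ∈ range n, ∫⁻ ω, backChain ω x j ∂envMeasure q := by ring
        _ ≤ _ := by
          refine (add_le_add_left h1 _).trans ?_
          push_cast
          rw [mul_add, mul_one, add_right_comm]
          exact add_le_add_left ih _
  have hc0 : ENNReal.ofReal c ≠ 0 := by simpa using hc
  have hfin := (le_add_self.trans (hstep n)).trans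
    (mul_le_mul_left (ENNReal.ofReal_le_ofReal ((div_le_iff₀ hc).1 hD)) (n : ℝ≥0∞))
  rw [ENNReal.ofReal_mul (Nat.cast_nonneg D), ENNReal.ofReal_natCast, mul_comm (D : ℝ≥0∞),
    mul_assoc] at hfin
  exact (ENNReal.mul_le_mul_iff_right hc0 ENNReal.ofReal_ne_top).1 hfin

theorem exists_measure_stay_le (hδ : 2 < ∑ i ∈ range M, (2 * (q i : ℝ) - 1)) :
    ∃ D : ℕ, 0 < D ∧ ∀ n t : ℕ,
      t * envMeasure q {ω | ∀ s ≤ t, |(walk ω s).1| < n} ≤ D * (2 * n + 1 : ℕ) := by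
  obtain ⟨D, hD⟩ := exists_sum_lintegral_backChain_le hq hM hδ
  refine ⟨2 * D + 1, by omega, fun n t => ?_⟩
  have hmj : ∀ j, Measurable fun ω => (backChain ω n j : ℝ≥0∞) := fun j =>
    (measurable_of_countable fun k : ℕ => (k : ℝ≥0∞)).comp (measurable_backChain n j)
  have hm : Measurable fun ω =>
      (2 * ∑ j ∈ range (2 * n + 1), (backChain ω n j : ℝ≥0∞) + (2 * n + 1 : ℕ)) :=
    ((Finset.measurable_sum _ fun j _ => hmj j).const_mul 2).add_const _
  have hle : envMeasure q {ω | ∀ s ≤ t, |(walk ω s).1| < n} ≤ envMeasure q {ω | (t : ℝ≥0∞)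
      ≤ 2 * ∑ j ∈ range (2 * n + 1), (backChain ω n j : ℝ≥0∞) + (2 * n + 1 : ℕ)} := by
    refine measure_mono_ae ?_
    filter_upwards [ae_envMeasure_exists_lt_succs hq] with ω hω h
    have := le_sum_backChain hω (n := n) (t := t) fun s hs => h s hs.le
    show (t : ℝ≥0∞) ≤ _
    calc (t : ℝ≥0∞) ≤ ((2 * ∑ j ∈ range (2 * n + 1), backChain ω n j + (2 * n + 1) : ℕ) : ℝ≥0∞) :=
          Nat.cast_le.2 this
      _ = _ := by push_cast; rfl
  refine (mul_le_mul_right hle _).trans ((mul_meas_ge_le_lintegral hm _).trans ?_)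
  rw [lintegral_add_right _ measurable_const, lintegral_const_mul _
    (Finset.measurable_sum _ fun j _ => hmj j), lintegral_finsetSum _ fun j _ => hmj j]
  simp only [lintegral_const, measure_univ, mul_one]
  refine (add_le_add_left (mul_le_mul_right (hD n (2 * n + 1)) 2) _).trans (le_of_eq ?_)
  push_cast
  ring

end Transient

theorem eventually_stay_of_tendsto_zero {x : ℕ → ℤ}
    (hx : Tendsto (fun n => (x n : ℝ) / n) atTop (𝓝 0)) (D : ℕ) :
    ∀ᶠ n : ℕ in atTop, ∀ s ≤ D * n, |x s| < n := by
  have h1 := hx.eventually (Metric.ball_mem_nhds 0 (by positivity : (0 : ℝ) < 1 / (D + 1)))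
  obtain ⟨S, hS⟩ := eventually_atTop.1 h1
  filter_upwards [eventually_gt_atTop ((range (S + 1)).sup fun s => (x s).natAbs)] with n hn s hs
  rcases Nat.lt_or_ge S s with h | h
  · have h2 := hS s h.le
    have hs0 : (0 : ℝ) < s := Nat.cast_pos.2 (by omega)
    rw [dist_zero_right, norm_div, Real.norm_eq_abs, Real.norm_natCast,
      div_lt_div_iff₀ hs0 (by positivity)] at h2
    have h3 : (s : ℝ) ≤ D * n := by exact_mod_cast hs
    have h4 : |(x s : ℝ)| < n := by nlinarith [abs_nonneg (x s : ℝ), Nat.cast_nonneg (α := ℝ) D]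
    exact_mod_cast h4
  · have h2 : (x s).natAbs < n :=
      (le_sup (f := fun s => (x s).natAbs) (mem_range.2 (Nat.lt_succ_of_le h))).trans_lt hn
    rw [Int.abs_eq_natAbs]
    exact Nat.cast_lt.2 h2

theorem IsCookieRW.speed_ne_zero {Ω : Type*} [MeasurableSpace Ω] {M : ℕ} {p : Fin M → ℝ}
    {P : Measure Ω} {X : ℕ → Ω → ℤ} (hX : IsCookieRW M p P X) {q : ℕ → unitInterval}
    (hqp : ∀ i, (q i : ℝ) = strength M p (i + 1)) (hq : ∀ i, 1 / 2 ≤ (q i : ℝ))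
    (hM : ∀ i, M ≤ i → (q i : ℝ) = 1 / 2) (hδ : 2 < ∑ i ∈ range M, (2 * (q i : ℝ) - 1)) {v : ℝ}
    (hv : ∀ᵐ ω ∂P, Tendsto (fun n => (X n ω : ℝ) / n) atTop (𝓝 v)) : v ≠ 0 := by
  rintro rfl
  have := hX.isProb
  obtain ⟨D, hD0, hD⟩ := exists_measure_stay_le hq hM hδ
  have hmeas : ∀ n : ℕ, MeasurableSet {ω | ∀ s ≤ 6 * D * n, |X s ω| < n} := by
    intro n
    have : {ω | ∀ s ≤ 6 * D * n, |X s ω| < n}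
        = ⋂ s, ⋂ (_ : s ≤ 6 * D * n), X s ⁻¹' {a | |a| < n} := by ext; simp
    rw [this]
    exact MeasurableSet.iInter fun s => MeasurableSet.iInter fun _ =>
      hX.meas s (Set.to_countable _).measurableSet
  have hlim : Tendsto (fun n : ℕ => P {ω | ∀ s ≤ 6 * D * n, |X s ω| < n}) atTop (𝓝 1) := by
    refine prob_tendsto_one_of_ae_eventually hmeas ?_
    filter_upwards [hv] with ω hω
    exact eventually_stay_of_tendsto_zero hω (6 * D)
  have hle : ∀ᶠ n : ℕ in atTop, P {ω | ∀ s ≤ 6 * D * n, |X s ω| < n} ≤ 1 / 2 := by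
    filter_upwards [eventually_ge_atTop 1] with n hn
    have htr := hX.measure_eq (isCookieRW_walk hqp) (6 * D * n) {a | ∀ k, |a k| < n}
    have hfin : ∀ Q : ℕ → Prop, (∀ k : Fin (6 * D * n + 1), Q k) ↔ ∀ s ≤ 6 * D * n, Q s :=
      fun Q => ⟨fun h s hs => h ⟨s, Nat.lt_succ_of_le hs⟩,
        fun h k => h k (Nat.le_of_lt_succ k.2)⟩
    have hsetX : {ω | ∀ s ≤ 6 * D * n, |X s ω| < n}
        = {ω | (fun k : Fin (6 * D * n + 1) => X k ω) ∈ {a | ∀ k, |a k| < (n : ℤ)}} :=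
      Set.ext fun ω => (hfin fun s => |X s ω| < n).symm
    have hsetW : {ω | (fun k : Fin (6 * D * n + 1) => (walk ω k).1) ∈ {a | ∀ k, |a k| < (n : ℤ)}}
        = {ω | ∀ s ≤ 6 * D * n, |(walk ω s).1| < n} :=
      Set.ext fun ω => hfin fun s => |(walk ω s).1| < n
    rw [hsetX, htr, hsetW]
    have h1 := hD n (6 * D * n)
    have h2 : ((D * (2 * n + 1 : ℕ) : ℕ) : ℝ≥0∞) ≤ ((3 * D * n : ℕ) : ℝ≥0∞) :=
      Nat.cast_le.2 (by nlinarith)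
    have h3 : ((6 * D * n : ℕ) : ℝ≥0∞) * (1 / 2) = ((3 * D * n : ℕ) : ℝ≥0∞) := by
      rw [mul_one_div, show 6 * D * n = 3 * D * n * 2 by ring, Nat.cast_mul _ 2, Nat.cast_two,
        ENNReal.mul_div_cancel_right two_ne_zero ENNReal.ofNat_ne_top]
    rw [← ENNReal.mul_le_mul_iff_right (a := ((6 * D * n : ℕ) : ℝ≥0∞))
      (Nat.cast_ne_zero.2 (by positivity)) (ENNReal.natCast_ne_top _), h3]
    refine h1.trans (le_trans (le_of_eq ?_) h2)
    push_cast; rfl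
  have := le_of_tendsto hlim hle
  exact absurd this (by rw [one_div, not_le]; exact ENNReal.inv_lt_one.2 (by norm_num))

/-- Law of the `j`-th value of the backward chain. -/
def backLaw (q : ℕ → unitInterval) (j : ℕ) : Measure ℕ :=
  (envMeasure q).map fun ω => backChain ω 0 j

instance (q : ℕ → unitInterval) (j : ℕ) : IsProbabilityMeasure (backLaw q j) :=
  Measure.isProbabilityMeasure_map (measurable_backChain 0 j).aemeasurable

theorem lintegral_backLaw (q : ℕ → unitInterval) (j : ℕ) (n : ℤ) (f : ℕ → ℝ≥0∞) :
    ∫⁻ y, f y ∂backLaw q j = ∫⁻ ω, f (backChain ω n j) ∂envMeasure q := by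
  rw [backLaw, lintegral_map (measurable_of_countable f) (measurable_backChain 0 j),
    lintegral_backChain, lintegral_backChain]

theorem lintegral_backLaw_succ (q : ℕ → unitInterval) (j : ℕ) (f : ℕ → ℝ≥0∞) :
    ∫⁻ y, f y ∂backLaw q (j + 1) = ∫⁻ y, backOp q f y ∂backLaw q j := by
  rw [lintegral_backLaw q _ 0, lintegral_backLaw q _ 0, lintegral_backChain_succ]

theorem natCast_eq_iSup_min (y : ℕ) : (y : ℝ≥0∞) = ⨆ K : ℕ, ((min y K : ℕ) : ℝ≥0∞) :=
  le_antisymm (le_iSup_of_le y (by simp)) (iSup_le fun K => Nat.cast_le.2 (min_le_left y K))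

theorem mean_eq_iSup (q : ℕ → unitInterval) (j : ℕ) : ∫⁻ y, (y : ℝ≥0∞) ∂backLaw q j
    = ⨆ K : ℕ, ∫⁻ y, ((min y K : ℕ) : ℝ≥0∞) ∂backLaw q j := by
  rw [← lintegral_iSup (fun K => measurable_of_countable _)
    fun K L h y => Nat.cast_le.2 (min_le_min_left y h)]
  exact lintegral_congr natCast_eq_iSup_min

section Recurrent

variable {q : ℕ → unitInterval} (hq : ∀ i, 1 / 2 ≤ (q i : ℝ))

include hq

theorem backOp_monotone {f : ℕ → ℝ≥0∞} (hf : Monotone f) : Monotone (backOp q f) := by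
  intro y z hyz
  refine lintegral_mono_ae ?_
  filter_upwards [ae_exists_lt_succs hq] with w hw
  exact hf (failsBefore_mono (hw z) hyz)

/-- The backward chain is stochastically nondecreasing in time. -/
theorem lintegral_backLaw_monotone {f : ℕ → ℝ≥0∞} (hf : Monotone f) :
    Monotone fun j => ∫⁻ y, f y ∂backLaw q j := by
  refine monotone_nat_of_le_succ fun j => ?_
  have hmono : Monotone ((backOp q)^[j] f) := by
    induction j with
    | zero => exact hf
    | succ j ih => rw [Function.iterate_succ_apply']; exact backOp_monotone hq ih
  rw [lintegral_backLaw q _ 0, lintegral_backLaw q _ 0, lintegral_backChain, lintegral_backChain,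
    Function.iterate_succ_apply']
  calc (backOp q)^[j] f 0 = ∫⁻ _, (backOp q)^[j] f 0 ∂siteMeasure q := by simp
    _ ≤ _ := lintegral_mono fun w => hmono (Nat.zero_le _)

theorem truncated_mean_le {C : ℕ} (hC : Tendsto (fun n : ℕ => envMeasure q
      {ω | ¬ ∑ j ∈ range n, backChain ω n (j + 1) ≤ C * n}) atTop (𝓝 0)) (K j : ℕ) :
    ∫⁻ y, ((min y K : ℕ) : ℝ≥0∞) ∂backLaw q j ≤ 2 * (C + 1) := by
  have hmono : Monotone fun y => ((min y K : ℕ) : ℝ≥0∞) :=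
    fun a b h => Nat.cast_le.2 (min_le_min_right K h)
  have hE := lintegral_backLaw_monotone hq hmono
  have hKp : Tendsto (fun n : ℕ => (K : ℝ≥0∞) * envMeasure q
      {ω | ¬ ∑ j ∈ range n, backChain ω n (j + 1) ≤ C * n}) atTop (𝓝 0) := by
    simpa using ENNReal.Tendsto.const_mul hC (Or.inr (ENNReal.natCast_ne_top K))
  obtain ⟨n, hn, hnp⟩ := ((eventually_ge_atTop (2 * j + 1)).and
    (hKp.eventually (gt_mem_nhds one_pos))).exists
  have hlower : (n : ℝ≥0∞) * ∫⁻ y, ((min y K : ℕ) : ℝ≥0∞) ∂backLaw q j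
      ≤ 2 * ∑ i ∈ range n, ∫⁻ y, ((min y K : ℕ) : ℝ≥0∞) ∂backLaw q (i + 1) := by
    have h1 : ((n - j : ℕ) : ℝ≥0∞) * ∫⁻ y, ((min y K : ℕ) : ℝ≥0∞) ∂backLaw q j
        ≤ ∑ i ∈ range n, ∫⁻ y, ((min y K : ℕ) : ℝ≥0∞) ∂backLaw q (i + 1) := by
      calc _ = ∑ i ∈ Ico j n, ∫⁻ y, ((min y K : ℕ) : ℝ≥0∞) ∂backLaw q j := by simp
        _ ≤ ∑ i ∈ Ico j n, ∫⁻ y, ((min y K : ℕ) : ℝ≥0∞) ∂backLaw q (i + 1) :=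
          sum_le_sum fun i hi => hE ((mem_Ico.1 hi).1.trans i.le_succ)
        _ ≤ _ := sum_le_sum_of_subset fun i hi => mem_range.2 (mem_Ico.1 hi).2
    calc (n : ℝ≥0∞) * ∫⁻ y, ((min y K : ℕ) : ℝ≥0∞) ∂backLaw q j
        ≤ ((2 * (n - j) : ℕ) : ℝ≥0∞) * ∫⁻ y, ((min y K : ℕ) : ℝ≥0∞) ∂backLaw q j :=
          mul_le_mul_left (Nat.cast_le.2 (by omega)) _
      _ ≤ _ := by
        rw [Nat.cast_mul, Nat.cast_two, mul_assoc]
        exact mul_le_mul_right h1 2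
  have hupper : ∑ i ∈ range n, ∫⁻ y, ((min y K : ℕ) : ℝ≥0∞) ∂backLaw q (i + 1)
      ≤ (C + 1) * n := by
    have hm : ∀ i, Measurable fun ω => ((min (backChain ω n i) K : ℕ) : ℝ≥0∞) := fun i =>
      (measurable_of_countable fun y : ℕ => ((min y K : ℕ) : ℝ≥0∞)).comp (measurable_backChain n i)
    have hms : Measurable fun ω : ℤ → ℕ → Bool => ∑ j ∈ range n, backChain ω n (j + 1) :=
      Finset.measurable_sum _ fun j _ => measurable_backChain n (j + 1)
    have hmS : MeasurableSet {ω : ℤ → ℕ → Bool | ¬ ∑ j ∈ range n, backChain ω n (j + 1) ≤ C * n} :=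
      hms (Set.to_countable {a : ℕ | ¬ a ≤ C * n}).measurableSet
    simp only [lintegral_backLaw q _ n]
    rw [← lintegral_finsetSum _ fun i _ => hm (i + 1)]
    calc _ ≤ ∫⁻ ω, (((C * n : ℕ) : ℝ≥0∞)
          + {ω : ℤ → ℕ → Bool | ¬ ∑ j ∈ range n, backChain ω n (j + 1) ≤ C * n}.indicator
            (fun _ => ((n * K : ℕ) : ℝ≥0∞)) ω) ∂envMeasure q := by
          refine lintegral_mono fun ω => ?_
          by_cases h : ω ∈ {ω : ℤ → ℕ → Bool | ¬ ∑ j ∈ range n, backChain ω n (j + 1) ≤ C * n}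
          · simp only [Set.indicator_of_mem h]
            refine le_add_left ?_
            rw [← Nat.cast_sum]
            refine Nat.cast_le.2 ((sum_le_sum fun i _ => min_le_right _ K).trans ?_)
            simp
          · simp only [Set.indicator_of_notMem h, add_zero]
            rw [← Nat.cast_sum]
            exact Nat.cast_le.2 ((sum_le_sum fun i _ => min_le_left _ K).trans (not_not.1 h))
      _ = C * n + n * (K * envMeasure q
            {ω | ¬ ∑ j ∈ range n, backChain ω n (j + 1) ≤ C * n}) := by
          rw [lintegral_add_left measurable_const, lintegral_indicator_const hmS]
          simp [mul_assoc]
      _ ≤ C * n + n * 1 := by gcongr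
      _ = _ := by ring
  have hn0 : (n : ℝ≥0∞) ≠ 0 := Nat.cast_ne_zero.2 (by omega)
  rw [← ENNReal.mul_le_mul_iff_right hn0 (ENNReal.natCast_ne_top n)]
  refine hlower.trans ((mul_le_mul_right hupper 2).trans (le_of_eq ?_))
  ring

/-- The laws of the backward chain are asymptotically uniformly integrable if their truncated
means are bounded. -/
theorem exists_lintegral_sub_le {C : ℝ≥0∞} (hC : C ≠ ∞)
    (hmean : ∀ K j : ℕ, ∫⁻ y, ((min y K : ℕ) : ℝ≥0∞) ∂backLaw q j ≤ C) {η : ℝ≥0∞} (hη : η ≠ 0) :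
    ∃ B j₀ : ℕ, ∀ j, j₀ ≤ j → ∫⁻ y, ((y - B : ℕ) : ℝ≥0∞) ∂backLaw q j ≤ η := by
  set m := ⨆ a : ℕ × ℕ, ∫⁻ y, ((min y a.1 : ℕ) : ℝ≥0∞) ∂backLaw q a.2 with hm
  have hmC : m ≤ C := iSup_le fun a => hmean a.1 a.2
  have hmtop : m ≠ ∞ := ne_top_of_le_ne_top hC hmC
  obtain ⟨⟨B, j₀⟩, ha⟩ : ∃ a : ℕ × ℕ,
      m < ∫⁻ y, ((min y a.1 : ℕ) : ℝ≥0∞) ∂backLaw q a.2 + η := by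
    by_contra! h
    have h1 : m + η ≤ m := by
      conv_lhs => rw [hm, ENNReal.iSup_add]
      exact iSup_le h
    exact absurd h1 (not_le.2 (ENNReal.lt_add_right hmtop hη))
  refine ⟨B, j₀, fun j hj => ?_⟩
  have hmono : Monotone fun y => ((min y B : ℕ) : ℝ≥0∞) :=
    fun a b h => Nat.cast_le.2 (min_le_min_right B h)
  have hsplit : ∫⁻ y, ((min y B : ℕ) : ℝ≥0∞) ∂backLaw q j + ∫⁻ y, ((y - B : ℕ) : ℝ≥0∞) ∂backLaw q j
      = ∫⁻ y, (y : ℝ≥0∞) ∂backLaw q j := by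
    rw [← lintegral_add_left (measurable_of_countable _)]
    refine lintegral_congr fun y => ?_
    rw [← Nat.cast_add]
    congr 1
    omega
  have hle : ∫⁻ y, (y : ℝ≥0∞) ∂backLaw q j ≤ m := by
    rw [mean_eq_iSup]
    exact iSup_le fun K => le_iSup
      (fun a : ℕ × ℕ => ∫⁻ y, ((min y a.1 : ℕ) : ℝ≥0∞) ∂backLaw q a.2) (K, j)
  refine (ENNReal.add_le_add_iff_left (ne_top_of_le_ne_top hC (hmean B j))).1 ?_
  rw [hsplit]
  refine hle.trans (ha.le.trans ?_)
  exact add_le_add_left (lintegral_backLaw_monotone hq hmono hj) η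

end Recurrent

/-- Test function which is quadratic on `[0, N]` and affine beyond `N`. -/
def testFun (a b N y : ℝ) : ℝ := y ^ 2 - a * y - b - max (y - N) 0 ^ 2

theorem testFun_tangent (a b N y z : ℝ) :
    testFun a b N z + (2 * z - a - 2 * max (z - N) 0) * (y - z) ≤ testFun a b N y := by
  unfold testFun
  rcases le_total (y - N) 0 with h1 | h1 <;> rcases le_total (z - N) 0 with h2 | h2 <;>
    simp only [max_eq_left, max_eq_right, h1, h2] <;> nlinarith [sq_nonneg (y - z)]

theorem testFun_le_mul {a b N y : ℝ} (ha : 0 ≤ a) (hb : 0 ≤ b) (hN : 0 ≤ N) (hy : 0 ≤ y) :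
    testFun a b N y ≤ 2 * N * y := by
  unfold testFun
  rcases le_total (y - N) 0 with h1 | h1 <;> simp only [max_eq_left, max_eq_right, h1] <;>
    nlinarith [mul_nonneg ha hy, mul_nonneg hN hy]

theorem one_le_testFun {a b N y m : ℝ} (ha : 0 ≤ a) (hb : 0 ≤ b) (hm : a + b + 1 ≤ m) (hy : m ≤ y)
    (hN : m ≤ N) : 1 ≤ testFun a b N y := by
  unfold testFun
  rcases le_total (y - N) 0 with h1 | h1 <;> simp only [max_eq_left, max_eq_right, h1]
  · nlinarith [mul_nonneg (by linarith : 0 ≤ y - 1) (by linarith : 0 ≤ y - a - b - 1)]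
  · nlinarith [mul_nonneg (by linarith : 0 ≤ N - 1) (by linarith : 0 ≤ N - a - b - 1),
      mul_nonneg h1 (by linarith : 0 ≤ 2 * N - a)]

section Drift

variable {q : ℕ → unitInterval} (hq : ∀ i, 1 / 2 ≤ (q i : ℝ)) {M : ℕ}
  (hM : ∀ i, M ≤ i → (q i : ℝ) = 1 / 2)

include hq hM

theorem integrable_excess_sq {N : ℝ} (hN : 0 ≤ N) (z : ℕ) :
    Integrable (fun w => max ((failsBefore z w : ℝ) - N) 0 ^ 2) (siteMeasure q) := by
  refine (integrable_failsBefore_sq hq hM z).mono'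
    ((((measurable_failsBefore_real z).sub_const N).max measurable_const).pow_const
      2).aestronglyMeasurable (ae_of_all _ fun w => ?_)
  rw [Real.norm_of_nonneg (by positivity)]
  have : (0 : ℝ) ≤ failsBefore z w := Nat.cast_nonneg _
  exact pow_le_pow_left₀ (le_max_right _ _) (max_le (by linarith) this) 2

theorem tendsto_integral_excess_sq (z : ℕ) :
    Tendsto (fun N : ℕ => ∫ w, max ((failsBefore z w : ℝ) - N) 0 ^ 2 ∂siteMeasure q) atTop
      (𝓝 0) := by
  suffices h : Tendsto (fun N : ℕ => ∫ w, max ((failsBefore z w : ℝ) - N) 0 ^ 2 ∂siteMeasure q)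
      atTop (𝓝 (∫ _, (0 : ℝ) ∂siteMeasure q)) by rwa [integral_zero] at h
  refine tendsto_integral_of_dominated_convergence (fun w => (failsBefore z w : ℝ) ^ 2)
    (fun N => (integrable_excess_sq hq hM (Nat.cast_nonneg N) z).aestronglyMeasurable)
    (integrable_failsBefore_sq hq hM z) (fun N => ae_of_all _ fun w => ?_)
    (ae_of_all _ fun w => ?_)
  · rw [Real.norm_of_nonneg (by positivity)]
    have h1 : (0 : ℝ) ≤ failsBefore z w := Nat.cast_nonneg _
    have h2 : (0 : ℝ) ≤ N := Nat.cast_nonneg _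
    exact pow_le_pow_left₀ (le_max_right _ _) (max_le (by linarith) h1) 2
  · refine tendsto_const_nhds.congr' ?_
    filter_upwards [eventually_ge_atTop (failsBefore z w)] with N hN
    rw [max_eq_right (sub_nonpos.2 (Nat.cast_le.2 hN))]
    simp

theorem integral_excess_sq_mono {N : ℝ} (hN : 0 ≤ N) {y z : ℕ} (hyz : y ≤ z) :
    ∫ w, max ((failsBefore y w : ℝ) - N) 0 ^ 2 ∂siteMeasure q
      ≤ ∫ w, max ((failsBefore z w : ℝ) - N) 0 ^ 2 ∂siteMeasure q := by
  refine integral_mono_ae (integrable_excess_sq hq hM hN y) (integrable_excess_sq hq hM hN z) ?_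
  filter_upwards [ae_exists_lt_succs hq] with w hw
  have h : (failsBefore y w : ℝ) ≤ failsBefore z w :=
    Nat.cast_le.2 (failsBefore_mono (hw z) hyz)
  exact pow_le_pow_left₀ (le_max_right _ _) (max_le_max (by linarith) le_rfl) 2

theorem integrable_quadratic (a b : ℝ) (z : ℕ) :
    Integrable (fun w => (failsBefore z w : ℝ) ^ 2 - a * failsBefore z w - b) (siteMeasure q) :=
  ((integrable_failsBefore_sq hq hM z).sub ((integrable_failsBefore hq hM z).const_mul a)).sub
    (integrable_const b)

theorem integrable_testFun (a b : ℝ) {N : ℝ} (hN : 0 ≤ N) (z : ℕ) :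
    Integrable (fun w => testFun a b N (failsBefore z w)) (siteMeasure q) :=
  (integrable_quadratic hq hM a b z).sub (integrable_excess_sq hq hM hN z)

theorem integrable_max_testFun (a b : ℝ) {N : ℝ} (hN : 0 ≤ N) (z : ℕ) :
    Integrable (fun w => max 0 (testFun a b N (failsBefore z w))) (siteMeasure q) :=
  (integrable_const 0).sup (integrable_testFun hq hM a b hN z)

theorem integral_testFun_le_max (a b : ℝ) {N : ℝ} (hN : 0 ≤ N) (z : ℕ) :
    ∫ w, testFun a b N (failsBefore z w) ∂siteMeasure q
      ≤ ∫ w, max 0 (testFun a b N (failsBefore z w)) ∂siteMeasure q :=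
  integral_mono (integrable_testFun hq hM a b hN z) (integrable_max_testFun hq hM a b hN z)
    fun _ => le_max_right _ _

theorem testFun_le_integral_add {a : ℝ} (hδ : ∑ i ∈ range M, (2 * (q i : ℝ) - 1) ≤ 2)
    (ha : |(1 - ∑ i ∈ range M, (2 * (q i : ℝ) - 1)) ^ 2 + 2 - ∑ i ∈ range M, (2 * (q i : ℝ) - 1)
      - ∑ i ∈ range M, (2 * (q i : ℝ) - 1) ^ 2| ≤ a) (b : ℝ) {N : ℝ} (hN : 0 ≤ N) {z : ℕ}
    (hz : M ≤ z) (haz : a ≤ 2 * z) :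
    testFun a b N z ≤ ∫ w, testFun a b N (failsBefore z w) ∂siteMeasure q
      + ∫ w, max ((failsBefore z w : ℝ) - N) 0 ^ 2 ∂siteMeasure q := by
  set δ : ℝ := ∑ i ∈ range M, (2 * (q i : ℝ) - 1) with hδ_def
  set κ : ℝ := ∑ i ∈ range M, (2 * (q i : ℝ) - 1) ^ 2 with hκ_def
  rw [← integral_add (integrable_testFun hq hM a b hN z) (integrable_excess_sq hq hM hN z)]
  have hI2 : Integrable (fun w => (failsBefore z w : ℝ) ^ 2 - a * failsBefore z w)
      (siteMeasure q) :=
    (integrable_failsBefore_sq hq hM z).sub ((integrable_failsBefore hq hM z).const_mul a)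
  have h1 : ∫ w, (testFun a b N (failsBefore z w) + max ((failsBefore z w : ℝ) - N) 0 ^ 2)
        ∂siteMeasure q
      = (z + 1 - δ) ^ 2 + 2 * (z + 1) - δ - κ - a * (z + 1 - δ) - b := by
    simp only [testFun, sub_add_cancel]
    rw [integral_sub hI2 (integrable_const b), integral_sub (integrable_failsBefore_sq hq hM z)
      ((integrable_failsBefore hq hM z).const_mul a), integral_const_mul,
      integral_failsBefore hq hM hz, integral_failsBefore_sq hq hM hz]
    simp only [integral_const, probReal_univ, smul_eq_mul, one_mul]
    ring
  rw [h1, testFun]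
  have h2 := (abs_le.1 ha).1
  nlinarith [mul_nonneg (sub_nonneg.2 hδ) (sub_nonneg.2 haz), sq_nonneg (max ((z : ℝ) - N) 0)]

theorem testFun_sub_le_integral {a : ℝ} (hδ : ∑ i ∈ range M, (2 * (q i : ℝ) - 1) ≤ 2)
    (ha : 0 ≤ a) (b : ℝ) {N : ℝ} (hN : 0 ≤ N) {z : ℕ} (hz : M ≤ z) :
    testFun a b N z - (2 * z + a) ≤ ∫ w, testFun a b N (failsBefore z w) ∂siteMeasure q := by
  have hδ0 : 0 ≤ ∑ i ∈ range M, (2 * (q i : ℝ) - 1) :=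
    sum_nonneg fun i _ => by linarith [hq i]
  set δ : ℝ := ∑ i ∈ range M, (2 * (q i : ℝ) - 1) with hδ_def
  set t : ℝ := 2 * z - a - 2 * max ((z : ℝ) - N) 0 with ht
  have hI : Integrable (fun w => (failsBefore z w : ℝ) - z) (siteMeasure q) :=
    (integrable_failsBefore hq hM z).sub (integrable_const _)
  have hI2 : Integrable (fun w => t * ((failsBefore z w : ℝ) - z)) (siteMeasure q) :=
    hI.const_mul t
  have hlin : ∫ w, (testFun a b N z + t * ((failsBefore z w : ℝ) - z)) ∂siteMeasure q
      = testFun a b N z + t * (1 - δ) := by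
    rw [integral_add (integrable_const _) hI2,
      integral_const_mul, integral_sub (integrable_failsBefore hq hM z) (integrable_const _),
      integral_failsBefore hq hM hz]
    simp only [integral_const, probReal_univ, smul_eq_mul, one_mul]
    ring
  have hmono := integral_mono
    ((integrable_const (testFun a b N z)).add hI2)
    (integrable_testFun hq hM a b hN z) fun w => testFun_tangent a b N (failsBefore z w) z
  refine le_trans ?_ (hlin.symm.le.trans hmono)
  have hz0 : (0 : ℝ) ≤ z := Nat.cast_nonneg z
  have hmax0 : 0 ≤ max ((z : ℝ) - N) 0 := le_max_right _ _
  have hmaxz : max ((z : ℝ) - N) 0 ≤ z := max_le (by linarith) hz0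
  have ht1 : |t * (1 - δ)| ≤ (2 * z + a) * 1 := by
    rw [abs_mul]
    exact mul_le_mul (abs_le.2 ⟨by linarith, by linarith⟩) (abs_le.2 ⟨by linarith, by linarith⟩)
      (abs_nonneg _) (by linarith)
  linarith [(abs_le.1 ht1).1]

end Drift

theorem siteMeasure_forall_false_pos {q : ℕ → unitInterval} (hq1 : ∀ i, (q i : ℝ) < 1) (m : ℕ) :
    0 < siteMeasure q {w | ∀ i < m, w i = false} := by
  have h : {w : ℕ → Bool | ∀ i < m, w i = false}
      = Set.pi (range m : Finset ℕ) fun _ => {false} := by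
    ext w; simp
  rw [h, siteMeasure, Measure.infinitePi_pi _ fun _ _ => measurableSet_singleton _]
  refine pos_iff_ne_zero.2 (Finset.prod_ne_zero_iff.2 fun i _ => ?_)
  rw [bernoulliMeasure_apply_of_notMem_of_mem _ (measurableSet_singleton _) (by simp) (by simp)]
  have h1 : (1 : ℝ) - q i ≠ 0 := (sub_pos.2 (hq1 i)).ne'
  simpa [← NNReal.coe_ne_zero] using h1

theorem le_failsBefore_of_forall_false {z m : ℕ} {w : ℕ → Bool} (h : ∃ m, z < succs w m)
    (hw : ∀ i < m, w i = false) : m ≤ failsBefore z w := by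
  have h0 : succs w m = 0 := sum_eq_zero fun i hi => by simp [hw i (mem_range.1 hi)]
  have h1 := succs_add_fails w m
  have h2 := fails_le_failsBefore h (m := m) (by omega)
  omega

section Subcritical

variable {q : ℕ → unitInterval} (hq : ∀ i, 1 / 2 ≤ (q i : ℝ)) (hq1 : ∀ i, (q i : ℝ) < 1)

include hq hq1

theorem exists_le_backOp (m : ℕ) : ∃ c : ℝ, 0 < c ∧ ∀ (f : ℕ → ℝ≥0∞),
    (∀ y, m ≤ y → 1 ≤ f y) → ∀ z, ENNReal.ofReal c ≤ backOp q f z := by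
  refine ⟨(siteMeasure q {w | ∀ i < m, w i = false}).toReal,
    ENNReal.toReal_pos (siteMeasure_forall_false_pos hq1 m).ne' (measure_ne_top _ _),
    fun f hf z => ?_⟩
  have hms : MeasurableSet {w : ℕ → Bool | ∀ i < m, w i = false} := by
    have : {w : ℕ → Bool | ∀ i < m, w i = false}
        = ⋂ i, ⋂ (_ : i < m), (fun w : ℕ → Bool => w i) ⁻¹' {false} := by ext; simp
    rw [this]
    exact MeasurableSet.iInter fun i => MeasurableSet.iInter fun _ =>
      measurable_pi_apply i (measurableSet_singleton _)
  rw [ENNReal.ofReal_toReal (measure_ne_top _ _), ← lintegral_indicator_one hms]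
  refine lintegral_mono_ae ?_
  filter_upwards [ae_exists_lt_succs hq] with w hw
  by_cases h : w ∈ {w : ℕ → Bool | ∀ i < m, w i = false}
  · rw [Set.indicator_of_mem h]
    exact hf _ (le_failsBefore_of_forall_false (hw z) h)
  · simp [Set.indicator_of_notMem h]

variable {M : ℕ} (hM : ∀ i, M ≤ i → (q i : ℝ) = 1 / 2)

include hM

/-- Drift inequality for the backward chain when the total bias is at most `2`: up to an
arbitrarily small error, truncated quadratic functions are strict submartingales near `0`. -/
theorem exists_testFun_drift (hδ : ∑ i ∈ range M, (2 * (q i : ℝ) - 1) ≤ 2) (D₀ : ℕ) :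
    ∃ D : ℕ, D₀ ≤ D ∧ ∃ c : ℝ, 0 < c ∧ ∀ (B : ℕ) (ε : ℝ), 0 < ε → ∃ (N : ℕ) (f : ℕ → ℝ≥0∞),
      (∀ y : ℕ, f y ≤ ((2 * N : ℕ) : ℝ≥0∞) * y) ∧
      ∀ z : ℕ, f z + {z | z ≤ D}.indicator (fun _ => ENNReal.ofReal c) z
        ≤ backOp q f z + ENNReal.ofReal ε + 8 * ((z - B : ℕ) : ℝ≥0∞) := by
  obtain ⟨a, ha⟩ : ∃ a, |(1 - ∑ i ∈ range M, (2 * (q i : ℝ) - 1)) ^ 2 + 2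
      - ∑ i ∈ range M, (2 * (q i : ℝ) - 1) - ∑ i ∈ range M, (2 * (q i : ℝ) - 1) ^ 2| = a :=
    ⟨_, rfl⟩
  have ha0 : 0 ≤ a := ha ▸ abs_nonneg _
  obtain ⟨A, hA⟩ := exists_nat_ge a
  set D := D₀ + M + A with hD
  have hAD : a ≤ D := hA.trans (Nat.cast_le.2 (by omega))
  set b : ℝ := (D : ℝ) ^ 2 with hb
  have hb0 : 0 ≤ b := by positivity
  obtain ⟨m, hm⟩ := exists_nat_ge (a + b + 1)
  obtain ⟨c, hc, hcf⟩ := exists_le_backOp hq hq1 m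
  refine ⟨D, by omega, c, hc, fun B ε hε => ?_⟩
  obtain ⟨N, hN, hNm⟩ := (((tendsto_integral_excess_sq hq hM (2 * B)).eventually
    (gt_mem_nhds hε)).and (eventually_ge_atTop m)).exists
  have hN0 : (0 : ℝ) ≤ N := Nat.cast_nonneg N
  have hNm' : (m : ℝ) ≤ N := Nat.cast_le.2 hNm
  refine ⟨N, fun y => ENNReal.ofReal (max 0 (testFun a b N y)), fun y => ?_, fun z => ?_⟩
  · rw [← Nat.cast_mul, ← ENNReal.ofReal_natCast]
    have := testFun_le_mul ha0 hb0 hN0 (Nat.cast_nonneg y)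
    refine ENNReal.ofReal_le_ofReal (max_le (Nat.cast_nonneg _) ?_)
    push_cast
    exact this
  have hz0 : (0 : ℝ) ≤ z := Nat.cast_nonneg z
  rcases le_or_gt z D with hz | hz
  · have hsq : testFun a b N z ≤ 0 := by
      have h1 : (z : ℝ) ^ 2 ≤ b := pow_le_pow_left₀ hz0 (Nat.cast_le.2 hz) 2
      unfold testFun
      linarith [mul_nonneg ha0 hz0, sq_nonneg (max ((z : ℝ) - N) 0)]
    beta_reduce
    rw [Set.indicator_of_mem (by exact hz), max_eq_left hsq, ENNReal.ofReal_zero, zero_add,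
      add_assoc]
    refine le_add_right (hcf _ (fun y hy => ?_) z)
    rw [← ENNReal.ofReal_one]
    exact ENNReal.ofReal_le_ofReal
      ((one_le_testFun ha0 hb0 hm (Nat.cast_le.2 hy) hNm').trans (le_max_right _ _))
  · have hzM : M ≤ z := by omega
    have hza : a ≤ z := hAD.trans (Nat.cast_le.2 hz.le)
    have hI0 : 0 ≤ ∫ w, max 0 (testFun a b N (failsBefore z w)) ∂siteMeasure q :=
      integral_nonneg fun w => le_max_left _ _
    have hImax := integral_testFun_le_max hq hM a b hN0 z
    rw [Set.indicator_of_notMem (by simpa using hz), add_zero,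
      backOp_ofReal (g := fun y => max 0 (testFun a b N y)) (fun y => le_max_left _ _)
        (integrable_max_testFun hq hM a b hN0 z), ← ENNReal.ofReal_add hI0 hε.le]
    rcases le_or_gt z (2 * B) with hzB | hzB
    · refine le_add_right (ENNReal.ofReal_le_ofReal (max_le (by positivity) ?_))
      have h1 := testFun_le_integral_add hq hM hδ ha.le b hN0 hzM (by linarith)
      have h2 := integral_excess_sq_mono hq hM hN0 hzB
      linarith
    · have h8 : (8 : ℝ≥0∞) * ((z - B : ℕ) : ℝ≥0∞) = ENNReal.ofReal (8 * (z - B : ℕ)) := by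
        rw [ENNReal.ofReal_mul (by norm_num), ENNReal.ofReal_natCast, ENNReal.ofReal_ofNat]
      rw [h8, ← ENNReal.ofReal_add (by positivity) (by positivity)]
      refine ENNReal.ofReal_le_ofReal (max_le (by positivity) ?_)
      have h1 := testFun_sub_le_integral hq hM hδ ha0 b hN0 hzM
      have h2 : (z : ℝ) ≤ 2 * (z - B : ℕ) := by exact_mod_cast (by omega : z ≤ 2 * (z - B))
      linarith

theorem not_forall_truncated_mean_le (hδ : ∑ i ∈ range M, (2 * (q i : ℝ) - 1) ≤ 2) (C : ℕ)
    (hC : ∀ K j : ℕ, ∫⁻ y, ((min y K : ℕ) : ℝ≥0∞) ∂backLaw q j ≤ C) : False := by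
  obtain ⟨D, hCD, c, hc, hdrift⟩ := exists_testFun_drift hq hq1 hM hδ (2 * C)
  have hmean : ∀ j, ∫⁻ y, (y : ℝ≥0∞) ∂backLaw q j ≤ C := fun j => by
    rw [mean_eq_iSup]; exact iSup_le fun K => hC K j
  obtain ⟨B, j₀, hB⟩ := exists_lintegral_sub_le hq (ENNReal.natCast_ne_top C) hC
    (η := ENNReal.ofReal (c / 64)) (by simpa using hc)
  obtain ⟨N, f, hf, hfd⟩ := hdrift B (c / 8) (by positivity)
  have hhalf : ∀ j, 1 / 2 ≤ backLaw q j {z | z ≤ D} := by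
    intro j
    have h1 := (mul_meas_ge_le_lintegral (μ := backLaw q j)
      (measurable_of_countable fun y : ℕ => (y : ℝ≥0∞)) ((D + 1 : ℕ) : ℝ≥0∞)).trans (hmean j)
    have h2 : backLaw q j {z | z ≤ D}ᶜ ≤ 1 / 2 := by
      have hset : {z | z ≤ D}ᶜ = {y : ℕ | ((D + 1 : ℕ) : ℝ≥0∞) ≤ y} := by
        ext y
        show ¬ y ≤ D ↔ ((D + 1 : ℕ) : ℝ≥0∞) ≤ y
        rw [Nat.cast_le]; omega
      rw [hset]
      have h3 : (C : ℝ≥0∞) ≤ ((D + 1 : ℕ) : ℝ≥0∞) * (1 / 2) := by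
        rw [mul_one_div, ENNReal.le_div_iff_mul_le (Or.inl two_ne_zero)
          (Or.inl ENNReal.ofNat_ne_top)]
        exact_mod_cast (by omega : C * 2 ≤ D + 1)
      exact (ENNReal.mul_le_mul_iff_right (Nat.cast_ne_zero.2 (by omega))
        (ENNReal.natCast_ne_top _)).1 (h1.trans h3)
    rw [prob_compl_eq_one_sub (Set.to_countable _).measurableSet, tsub_le_iff_right] at h2
    rw [← ENNReal.add_le_add_iff_left (a := 1 / 2) (by simp), ENNReal.add_halves]
    exact h2
  have hstep : ∀ j, j₀ ≤ j → ∫⁻ y, f y ∂backLaw q j + ENNReal.ofReal (c / 4)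
      ≤ ∫⁻ y, f y ∂backLaw q (j + 1) := by
    intro j hj
    have h1 : ∫⁻ y, f y ∂backLaw q j + ENNReal.ofReal c * backLaw q j {z | z ≤ D}
        ≤ ∫⁻ y, f y ∂backLaw q (j + 1) + ENNReal.ofReal (c / 8)
          + 8 * ∫⁻ y, ((y - B : ℕ) : ℝ≥0∞) ∂backLaw q j := by
      rw [lintegral_backLaw_succ, ← lintegral_const_mul _ (measurable_of_countable _),
        ← lintegral_indicator_const (Set.to_countable _).measurableSet,
        ← lintegral_add_left (measurable_of_countable _)]
      refine (lintegral_mono hfd).trans (le_of_eq ?_)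
      rw [lintegral_add_left (measurable_of_countable _),
        lintegral_add_left (measurable_of_countable _), lintegral_const, measure_univ, mul_one]
    have h2 : ENNReal.ofReal (c / 4) + ENNReal.ofReal (c / 4)
        ≤ ENNReal.ofReal c * backLaw q j {z | z ≤ D} := by
      refine le_trans (le_of_eq ?_) (mul_le_mul_right (hhalf j) _)
      rw [← ENNReal.ofReal_add (by positivity) (by positivity), mul_one_div,
        ← ENNReal.ofReal_ofNat 2, ← ENNReal.ofReal_div_of_pos two_pos]
      congr 1; ring
    have h3 : ENNReal.ofReal (c / 8) + 8 * ∫⁻ y, ((y - B : ℕ) : ℝ≥0∞) ∂backLaw q j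
        ≤ ENNReal.ofReal (c / 4) := by
      refine (add_le_add_right (mul_le_mul_right (hB j hj) 8) _).trans (le_of_eq ?_)
      rw [← ENNReal.ofReal_ofNat 8, ← ENNReal.ofReal_mul (by norm_num),
        ← ENNReal.ofReal_add (by positivity) (by positivity)]
      congr 1; ring
    rw [← ENNReal.add_le_add_iff_left (a := ENNReal.ofReal (c / 4)) ENNReal.ofReal_ne_top]
    calc _ = ∫⁻ y, f y ∂backLaw q j + (ENNReal.ofReal (c / 4) + ENNReal.ofReal (c / 4)) := by ring
      _ ≤ _ := add_le_add_right h2 _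
      _ ≤ _ := h1
      _ = ∫⁻ y, f y ∂backLaw q (j + 1) + (ENNReal.ofReal (c / 8)
          + 8 * ∫⁻ y, ((y - B : ℕ) : ℝ≥0∞) ∂backLaw q j) := add_assoc _ _ _
      _ ≤ _ := add_le_add_right h3 _
      _ = _ := add_comm _ _
  have hgrow : ∀ k : ℕ, k * ENNReal.ofReal (c / 4) ≤ ∫⁻ y, f y ∂backLaw q (j₀ + k) := by
    intro k
    induction k with
    | zero => simp
    | succ k ih =>
      rw [Nat.cast_succ, add_mul, one_mul]
      exact (add_le_add_left ih _).trans (hstep (j₀ + k) (Nat.le_add_right _ _))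
  have hbound : ∀ j, ∫⁻ y, f y ∂backLaw q j ≤ ((2 * N * C : ℕ) : ℝ≥0∞) := by
    intro j
    refine (lintegral_mono hf).trans ?_
    rw [lintegral_const_mul _ (measurable_of_countable _), Nat.cast_mul _ C]
    exact mul_le_mul_right (hmean j) _
  obtain ⟨k, hk⟩ := exists_nat_gt (((2 * N * C : ℕ) : ℝ) / (c / 4))
  have h1 := (hgrow k).trans (hbound _)
  rw [← ENNReal.ofReal_natCast k, ← ENNReal.ofReal_mul (Nat.cast_nonneg k),
    ← ENNReal.ofReal_natCast, ENNReal.ofReal_le_ofReal_iff (Nat.cast_nonneg _)] at h1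
  rw [div_lt_iff₀ (by positivity)] at hk
  linarith

end Subcritical

theorem IsCookieRW.not_speed_pos {Ω : Type*} [MeasurableSpace Ω] {M : ℕ} {p : Fin M → ℝ}
    {P : Measure Ω} {X : ℕ → Ω → ℤ} (hX : IsCookieRW M p P X) {q : ℕ → unitInterval}
    (hqp : ∀ i, (q i : ℝ) = strength M p (i + 1)) (hq : ∀ i, 1 / 2 ≤ (q i : ℝ))
    (hq1 : ∀ i, (q i : ℝ) < 1) (hM : ∀ i, M ≤ i → (q i : ℝ) = 1 / 2)
    (hδ : ∑ i ∈ range M, (2 * (q i : ℝ) - 1) ≤ 2) {v : ℝ}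
    (hv : ∀ᵐ ω ∂P, Tendsto (fun n => (X n ω : ℝ) / n) atTop (𝓝 v)) : ¬ 0 < v := by
  intro hv0
  have := hX.isProb
  obtain ⟨C, hC⟩ := exists_nat_gt (2 / v)
  have hC0 : 0 < C := Nat.cast_pos.1 ((by positivity : 0 < 2 / v).trans hC)
  have hlim : Tendsto (fun n : ℕ => P {ω | (n : ℤ) ≤ X (C * n) ω}) atTop (𝓝 1) := by
    refine prob_tendsto_one_of_ae_eventually (fun n =>
      hX.meas (C * n) (Set.to_countable {a : ℤ | (n : ℤ) ≤ a}).measurableSet) ?_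
    filter_upwards [hv] with ω hω
    have h1 := (hω.eventually (lt_mem_nhds (half_lt_self hv0)))
    have h2 : Tendsto (fun n : ℕ => C * n) atTop atTop :=
      tendsto_id.const_mul_atTop' hC0
    filter_upwards [h2.eventually h1, eventually_gt_atTop 0] with n hn hn0
    have hpos : (0 : ℝ) < (C * n : ℕ) := Nat.cast_pos.2 (by positivity)
    rw [lt_div_iff₀ hpos] at hn
    rw [div_lt_iff₀ hv0] at hC
    have hn0' : (0 : ℝ) < n := Nat.cast_pos.2 hn0
    have : (n : ℝ) ≤ X (C * n) ω := by
      push_cast at hn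
      nlinarith
    exact_mod_cast this
  have hle : ∀ n : ℕ, P {ω | (n : ℤ) ≤ X (C * n) ω}
      ≤ envMeasure q {ω | ∑ j ∈ range n, backChain ω n (j + 1) ≤ C * n} := by
    intro n
    have htr := hX.measure_eq (isCookieRW_walk hqp) (C * n) {a | (n : ℤ) ≤ a (Fin.last _)}
    refine (le_of_eq htr).trans (measure_mono fun ω h => sum_backChain_le ?_)
    exact h
  have hms : ∀ n : ℕ, MeasurableSet
      {ω : ℤ → ℕ → Bool | ∑ j ∈ range n, backChain ω n (j + 1) ≤ C * n} := fun n =>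
    (Finset.measurable_sum _ fun j _ => measurable_backChain n (j + 1))
      (Set.to_countable {a : ℕ | a ≤ C * n}).measurableSet
  have hzero : Tendsto (fun n : ℕ => envMeasure q
      {ω | ¬ ∑ j ∈ range n, backChain ω n (j + 1) ≤ C * n}) atTop (𝓝 0) := by
    have h1 : Tendsto (fun n : ℕ => 1 - P {ω | (n : ℤ) ≤ X (C * n) ω}) atTop (𝓝 (1 - 1)) :=
      ENNReal.Tendsto.sub tendsto_const_nhds hlim (Or.inl ENNReal.one_ne_top)
    rw [tsub_self] at h1
    refine tendsto_of_tendsto_of_tendsto_of_le_of_le tendsto_const_nhds h1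
      (fun _ => zero_le) fun n => ?_
    refine (le_of_eq (prob_compl_eq_one_sub (hms n))).trans ?_
    exact tsub_le_tsub_left (hle n) 1
  refine not_forall_truncated_mean_le hq hq1 hM hδ (2 * (C + 1)) fun K j => ?_
  refine (truncated_mean_le hq hzero K j).trans (le_of_eq ?_)
  push_cast
  rfl

theorem cookieAlpha_eq_sum_strength {M : ℕ} (p : Fin M → ℝ) :
    cookieAlpha M p = ∑ i ∈ range M, (2 * strength M p (i + 1) - 1) - 1 := by
  rw [cookieAlpha, ← Fin.sum_univ_eq_sum_range]
  congr 1
  refine sum_congr rfl fun i _ => ?_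
  rw [strength, dif_pos ⟨Nat.le_add_left 1 i, i.2⟩]
  rfl

/-- **Theorem 1.1.** The speed of an `(M,p̄)`-cookie random walk is strictly positive
if and only if `α(M,p̄) > 1`. -/
theorem speed_positive_iff_alpha_gt_one
    (M : ℕ) (hM : 1 ≤ M) (p : Fin M → ℝ) (hp : ∀ i, 1 / 2 ≤ p i ∧ p i < 1)
    {Ω : Type*} [MeasurableSpace Ω] (P : Measure Ω) (X : ℕ → Ω → ℤ)
    (hX : IsCookieRW M p P X) (v : ℝ)
    (hv : ∀ᵐ ω ∂P, Tendsto (fun n => (X n ω : ℝ) / n) atTop (𝓝 v)) :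
    0 < v ↔ 1 < cookieAlpha M p := by
  have hq : ∀ i, 1 / 2 ≤ strength M p (i + 1) :=
    fun i => half_le_strength (fun i => (hp i).1) (i + 1)
  have hq1 : ∀ i, strength M p (i + 1) < 1 := by
    intro i
    unfold strength
    split_ifs with h
    · exact (hp _).2
    · norm_num
  have hqM : ∀ i, M ≤ i → strength M p (i + 1) = 1 / 2 :=
    fun i hi => dif_neg (by omega)
  let q : ℕ → unitInterval := fun i =>
    ⟨strength M p (i + 1), by linarith [hq i], (hq1 i).le⟩
  rw [cookieAlpha_eq_sum_strength, lt_sub_iff_add_lt, one_add_one_eq_two]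
  constructor
  · intro h
    by_contra hδ
    exact hX.not_speed_pos (q := q) (fun _ => rfl) hq hq1 hqM (not_lt.1 hδ) hv h
  · intro hδ
    exact (hX.speed_nonneg (fun i => (hp i).1) hv).lt_of_ne'
      (hX.speed_ne_zero (q := q) (fun _ => rfl) hq hqM hδ hv)

end
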